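/- arXiv:2001.01615 — 8 statements merged into one kernel-verified Lean document; each statement's English description precedes it below -/
import Mathlib

section
/- Let 0 < b < a and let R be the open rectangle {x | 0 < x 0 < a and 0 < x 1 < b} in EuclideanSpace ℝ (Fin 2). Let S be a nonempty open connected subset of R such that T := R \ closure(S) is also nonempty and connected, and set Γ := R ∩ frontier(S). Then ℋ¹(Γ) · vol(R) ≥ (4/a) · vol(S) · vol(T). (Lemma 1, lower-bound part: every admissible cut of the rectangle has Ratio Cut value at least 4/a.) -/
open MeasureTheory
open scoped ENNReal

open Set

/-! ### Paths, slices and Lipschitz projections in the plane -/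

/-- A path which starts in an open set and ends outside of it meets the frontier of that set,
at a time different from the initial one. -/
lemma exists_mem_frontier_of_path {X : Type*} [TopologicalSpace X] {D : Set X} (hD : IsOpen D)
    {γ : ℝ → X} (hγ : Continuous γ) {u v : ℝ} (huv : u ≤ v) (hu : γ u ∈ D) (hv : γ v ∉ D) :
    ∃ t ∈ Ioc u v, γ t ∈ frontier D := by
  by_contra! h
  have hsub : γ '' Icc u v ⊆ D ∪ (closure D)ᶜ := by
    rintro _ ⟨t, ht, rfl⟩
    rcases eq_or_lt_of_le ht.1 with rfl | hlt
    · exact Or.inl hu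
    · by_cases htD : γ t ∈ D
      · exact Or.inl htD
      · refine Or.inr fun hcl => h t ⟨hlt, ht.2⟩ ?_
        rw [hD.frontier_eq]
        exact ⟨hcl, htD⟩
  have := (isPreconnected_Icc.image γ hγ.continuousOn).subset_left_of_subset_union hD
    isClosed_closure.isOpen_compl (disjoint_compl_right.mono_left subset_closure) hsub
    ⟨γ u, mem_image_of_mem γ (left_mem_Icc.2 huv), hu⟩
  exact hv (this (mem_image_of_mem γ (right_mem_Icc.2 huv)))

lemma volume_le_of_forall_exists {X : Type*} [EMetricSpace X] [MeasurableSpace X] [BorelSpace X]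
    {f : X → ℝ} {K : NNReal} (hf : LipschitzWith K f) {W : Set ℝ} {G : Set X}
    (h : ∀ w ∈ W, ∃ z ∈ G, f z = w) : volume W ≤ K * μH[1] G := by
  calc volume W ≤ volume (f '' G) := measure_mono h
    _ = μH[1] (f '' G) := by rw [hausdorffMeasure_real]
    _ ≤ (K : ℝ≥0∞) ^ (1 : ℝ) * μH[1] G := hf.hausdorffMeasure_image_le zero_le_one G
    _ = K * μH[1] G := by rw [ENNReal.rpow_one]

lemma lipschitzWith_coord (i : Fin 2) :
    LipschitzWith 1 (fun z : EuclideanSpace ℝ (Fin 2) => z i) := by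
  refine LipschitzWith.of_dist_le_mul fun x y => ?_
  rw [NNReal.coe_one, one_mul, dist_eq_norm, dist_eq_norm]
  exact PiLp.norm_apply_le (x - y) i

lemma lipschitzWith_sub_coord :
    LipschitzWith (NNReal.sqrt 2) (fun z : EuclideanSpace ℝ (Fin 2) => z 0 - z 1) := by
  refine LipschitzWith.of_dist_le_mul fun x y => ?_
  rw [EuclideanSpace.dist_eq, Fin.sum_univ_two, Real.dist_eq, Real.dist_eq, Real.dist_eq,
    sq_abs, sq_abs, Real.coe_sqrt, NNReal.coe_ofNat, ← Real.sqrt_mul zero_le_two]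
  refine Real.abs_le_sqrt ?_
  nlinarith [sq_nonneg ((x 0 - y 0) + (x 1 - y 1))]

lemma volume_le_hausdorffMeasure_of_coord (i : Fin 2) {W : Set ℝ}
    {G : Set (EuclideanSpace ℝ (Fin 2))} (h : ∀ w ∈ W, ∃ z ∈ G, z i = w) :
    volume W ≤ μH[1] G := by
  simpa using volume_le_of_forall_exists (lipschitzWith_coord i) h

/-- The slice of a planar set above the point `s` of the first axis. -/
def columnSlice (D : Set (EuclideanSpace ℝ (Fin 2))) (s : ℝ) : Set ℝ := {y | !₂[s, y] ∈ D}

lemma mem_columnSlice {D : Set (EuclideanSpace ℝ (Fin 2))} {s y : ℝ} :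
    y ∈ columnSlice D s ↔ !₂[s, y] ∈ D := Iff.rfl

lemma IsOpen.columnSlice {D : Set (EuclideanSpace ℝ (Fin 2))} (hD : IsOpen D) (s : ℝ) :
    IsOpen (columnSlice D s) :=
  hD.preimage (by fun_prop : Continuous fun y : ℝ => (!₂[s, y] : EuclideanSpace ℝ (Fin 2)))

lemma measurePreserving_toLp_pair :
    MeasurePreserving (fun p : ℝ × ℝ => (!₂[p.1, p.2] : EuclideanSpace ℝ (Fin 2))) := by
  have := (PiLp.volume_preserving_toLp (Fin 2)).comp (volume_preserving_finTwoArrow ℝ).symm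
  exact this

lemma volume_eq_lintegral_columnSlice {D : Set (EuclideanSpace ℝ (Fin 2))} (hD : IsOpen D) :
    volume D = ∫⁻ s, volume (columnSlice D s) := by
  rw [← measurePreserving_toLp_pair.measure_preimage hD.measurableSet.nullMeasurableSet,
    Measure.volume_eq_prod,
    Measure.prod_apply (measurePreserving_toLp_pair.measurable hD.measurableSet)]
  rfl

/-! ### Projection estimates for open subsets of the quadrant -/

/-- The part of the frontier of `D` inside the open first quadrant. -/
def quadrantFrontier (D : Set (EuclideanSpace ℝ (Fin 2))) : Set (EuclideanSpace ℝ (Fin 2)) :=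
  {z | 0 < z 0 ∧ 0 < z 1} ∩ frontier D

section Quadrant

variable {D : Set (EuclideanSpace ℝ (Fin 2))}

/-- Horizontal projection estimate between two columns. -/
lemma volume_columnSlice_inter_le (hD : IsOpen D) (hDQ : D ⊆ {z | 0 < z 0 ∧ 0 < z 1})
    {s e : ℝ} (hse : s ≤ e) (J : Set ℝ) :
    volume (columnSlice D s ∩ J) ≤ volume (columnSlice D e ∩ J) +
      μH[1] (quadrantFrontier D ∩ {z | z 0 ∈ Ioc s e ∧ z 1 ∈ J}) := by
  have hW : volume ((columnSlice D s ∩ J) \ (columnSlice D e ∩ J)) ≤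
      μH[1] (quadrantFrontier D ∩ {z | z 0 ∈ Ioc s e ∧ z 1 ∈ J}) := by
    refine volume_le_hausdorffMeasure_of_coord 1 ?_
    rintro y ⟨⟨hys, hyJ⟩, hye⟩
    have hpos := hDQ hys
    simp only [mem_ofPred_eq, Matrix.cons_val_zero, Matrix.cons_val_one] at hpos
    obtain ⟨t, ht, htf⟩ := exists_mem_frontier_of_path hD
      (by fun_prop : Continuous fun t : ℝ => (!₂[t, y] : EuclideanSpace ℝ (Fin 2))) hse hys
      fun h => hye ⟨h, hyJ⟩
    exact ⟨_, ⟨⟨⟨hpos.1.trans ht.1, hpos.2⟩, htf⟩, ht, hyJ⟩, rfl⟩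
  calc volume (columnSlice D s ∩ J)
      ≤ volume ((columnSlice D e ∩ J) ∪ ((columnSlice D s ∩ J) \ (columnSlice D e ∩ J))) := by
        rw [union_sdiff_self]; exact measure_mono subset_union_right
    _ ≤ _ := (measure_union_le _ _).trans (by gcongr)

/-- Diagonal projection estimate between two columns, above a horizontal segment inside `D`. -/
lemma volume_columnSlice_inter_Ioi_le (hD : IsOpen D) (hDQ : D ⊆ {z | 0 < z 0 ∧ 0 < z 1})
    {s e c : ℝ} (hse : s ≤ e) (hc : ∀ x ∈ Icc s e, !₂[x, c] ∈ D) :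
    ENNReal.ofReal (e - s) + volume (columnSlice D s ∩ Ioi c) ≤
      volume (columnSlice D e ∩ Ioi c) + NNReal.sqrt 2 *
        μH[1] (quadrantFrontier D ∩ {z | z 0 ∈ Ioc s e ∧ z 1 ∈ Ioi c}) := by
  have hpres (x : ℝ) : volume ((x - ·) ⁻¹' (columnSlice D x ∩ Ioi c)) =
      volume (columnSlice D x ∩ Ioi c) :=
    (Measure.measurePreserving_sub_left volume x).measure_preimage
      ((hD.columnSlice x).inter isOpen_Ioi).measurableSet.nullMeasurableSet
  set W : Set ℝ := Ioo (s - c) (e - c) ∪ (s - ·) ⁻¹' (columnSlice D s ∩ Ioi c)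
  have hvol : volume W = ENNReal.ofReal (e - s) + volume (columnSlice D s ∩ Ioi c) := by
    rw [measure_union, hpres, Real.volume_Ioo, sub_sub_sub_cancel_right]
    · refine Set.disjoint_left.2 fun v hv hv' => ?_
      have := hv'.2
      simp only [mem_Ioi] at this
      linarith [hv.1]
    · exact ((hD.columnSlice s).inter isOpen_Ioi).measurableSet.preimage (by fun_prop)
  have hpath (v : ℝ) : Continuous fun t : ℝ => (!₂[t, t - v] : EuclideanSpace ℝ (Fin 2)) := by
    fun_prop
  have hW : volume (W \ (e - ·) ⁻¹' (columnSlice D e ∩ Ioi c)) ≤ NNReal.sqrt 2 *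
      μH[1] (quadrantFrontier D ∩ {z | z 0 ∈ Ioc s e ∧ z 1 ∈ Ioi c}) := by
    refine volume_le_of_forall_exists lipschitzWith_sub_coord ?_
    rintro v ⟨hvW, hve⟩
    obtain ⟨x, hxs, hxe, hxc, hxD, hev⟩ :
        ∃ x, s ≤ x ∧ x ≤ e ∧ c ≤ x - v ∧ !₂[x, x - v] ∈ D ∧ c < e - v := by
      rcases hvW with ⟨h1, h2⟩ | ⟨h1, h2⟩
      · refine ⟨v + c, by linarith, by linarith, by linarith, ?_, by linarith⟩
        rw [add_sub_cancel_left]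
        exact hc _ ⟨by linarith, by linarith⟩
      · simp only [mem_Ioi] at h2
        exact ⟨s, le_rfl, hse, h2.le, h1, by linarith⟩
    have hpos := hDQ hxD
    simp only [mem_ofPred_eq, Matrix.cons_val_zero, Matrix.cons_val_one] at hpos
    obtain ⟨t, ht, htf⟩ := exists_mem_frontier_of_path hD (hpath v) hxe hxD
      fun h => hve ⟨h, hev⟩
    refine ⟨_, ⟨⟨⟨hpos.1.trans ht.1, ?_⟩, htf⟩, ⟨hxs.trans_lt ht.1, ht.2⟩, ?_⟩, ?_⟩
    · change 0 < t - v
      linarith [ht.1]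
    · change c < t - v
      linarith [ht.1]
    · change t - (t - v) = v
      ring
  calc ENNReal.ofReal (e - s) + volume (columnSlice D s ∩ Ioi c) = volume W := hvol.symm
    _ ≤ volume ((e - ·) ⁻¹' (columnSlice D e ∩ Ioi c) ∪
          (W \ (e - ·) ⁻¹' (columnSlice D e ∩ Ioi c))) := by
        rw [union_sdiff_self]; exact measure_mono subset_union_right
    _ ≤ _ := (measure_union_le _ _).trans (by rw [hpres]; gcongr)

lemma measurableSet_coord_mem (i : Fin 2) {I : Set ℝ} (hI : MeasurableSet I) :
    MeasurableSet {z : EuclideanSpace ℝ (Fin 2) | z i ∈ I} :=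
  hI.preimage (by fun_prop : Measurable fun z : EuclideanSpace ℝ (Fin 2) => z i)

lemma measurableSet_quadrantFrontier : MeasurableSet (quadrantFrontier D) :=
  ((measurableSet_coord_mem 0 measurableSet_Ioi).inter
    (measurableSet_coord_mem 1 measurableSet_Ioi)).inter isClosed_frontier.measurableSet

lemma hausdorffMeasure_quadrantFrontier_add_le {I J K : Set ℝ} (hJ : MeasurableSet J)
    (hIJ : Disjoint I J) (hIK : I ⊆ K) (hJK : J ⊆ K) :
    μH[1] (quadrantFrontier D ∩ {z | z 0 ∈ I}) + μH[1] (quadrantFrontier D ∩ {z | z 0 ∈ J}) ≤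
      μH[1] (quadrantFrontier D ∩ {z | z 0 ∈ K}) := by
  rw [← measure_union _ (measurableSet_quadrantFrontier.inter (measurableSet_coord_mem 0 hJ))]
  · exact measure_mono (union_subset (inter_subset_inter_right _ fun z hz => hIK hz)
      (inter_subset_inter_right _ fun z hz => hJK hz))
  · exact Set.disjoint_left.2 fun z hz hz' => Set.disjoint_left.1 hIJ hz.2 hz'.2

/-- Increment estimate across a vertical strip traversed by a horizontal segment inside `D`. -/
lemma length_add_volume_columnSlice_le_of_segment (hD : IsOpen D)
    (hDQ : D ⊆ {z | 0 < z 0 ∧ 0 < z 1}) {s e c : ℝ} (hse : s ≤ e)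
    (hc : ∀ x ∈ Icc s e, !₂[x, c] ∈ D) :
    ENNReal.ofReal (e - s) + volume (columnSlice D s) ≤ volume (columnSlice D e) +
      NNReal.sqrt 2 * μH[1] (quadrantFrontier D ∩ {z | z 0 ∈ Ioc s e}) := by
  have hsplit (x : ℝ) : volume (columnSlice D x) =
      volume (columnSlice D x ∩ Ioi c) + volume (columnSlice D x ∩ Iic c) := by
    rw [← measure_inter_add_sdiff _ measurableSet_Ioi, sdiff_eq, compl_Ioi]
  have hone : (1 : ℝ≥0∞) ≤ NNReal.sqrt 2 := by
    rw [ENNReal.one_le_coe_iff, NNReal.one_le_sqrt]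
    exact one_le_two
  have hΓ : μH[1] (quadrantFrontier D ∩ {z | z 0 ∈ Ioc s e ∧ z 1 ∈ Ioi c}) +
      μH[1] (quadrantFrontier D ∩ {z | z 0 ∈ Ioc s e ∧ z 1 ∈ Iic c}) ≤
      μH[1] (quadrantFrontier D ∩ {z | z 0 ∈ Ioc s e}) := by
    rw [← measure_union]
    · exact measure_mono (union_subset (inter_subset_inter_right _ fun z hz => hz.1)
        (inter_subset_inter_right _ fun z hz => hz.1))
    · exact Set.disjoint_left.2 fun z hz hz' => not_lt_of_ge (mem_Iic.1 hz'.2.2) hz.2.2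
    · exact measurableSet_quadrantFrontier.inter
        ((measurableSet_coord_mem 0 measurableSet_Ioc).inter (measurableSet_coord_mem 1 measurableSet_Iic))
  rw [hsplit s, hsplit e, ← add_assoc]
  calc _ ≤ _ := add_le_add (volume_columnSlice_inter_Ioi_le hD hDQ hse hc)
        (volume_columnSlice_inter_le hD hDQ hse (Iic c))
    _ ≤ _ := add_le_add le_rfl (add_le_add le_rfl (le_mul_of_one_le_left zero_le hone))
    _ = volume (columnSlice D e ∩ Ioi c) + volume (columnSlice D e ∩ Iic c) + NNReal.sqrt 2 *
          (μH[1] (quadrantFrontier D ∩ {z | z 0 ∈ Ioc s e ∧ z 1 ∈ Ioi c}) +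
            μH[1] (quadrantFrontier D ∩ {z | z 0 ∈ Ioc s e ∧ z 1 ∈ Iic c})) := by ring
    _ ≤ _ := by gcongr

/-- Increment estimate across a vertical strip all of whose columns meet `D`. -/
lemma length_add_volume_columnSlice_le (hD : IsOpen D) (hDQ : D ⊆ {z | 0 < z 0 ∧ 0 < z 1})
    {s e : ℝ} (hse : s ≤ e) (hc : ∀ x ∈ Icc s e, (columnSlice D x).Nonempty) :
    ENNReal.ofReal (e - s) + volume (columnSlice D s) ≤ volume (columnSlice D e) +
      NNReal.sqrt 2 * μH[1] (quadrantFrontier D ∩ {z | z 0 ∈ Ioc s e}) := by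
  obtain ⟨t, ht0, htmono, ⟨m, hm⟩, ht⟩ := exists_monotone_Icc_subset_open_cover_Icc hse
    (c := fun y : ℝ => {x : Icc s e | !₂[(x : ℝ), y] ∈ D})
    (fun y => hD.preimage (by fun_prop))
    (fun x _ => mem_iUnion.2 (hc x x.2))
  have key (n : ℕ) : ENNReal.ofReal (t n - s) + volume (columnSlice D s) ≤
      volume (columnSlice D (t n)) +
        NNReal.sqrt 2 * μH[1] (quadrantFrontier D ∩ {z | z 0 ∈ Ioc s (t n : ℝ)}) := by
    induction n with
    | zero => simp [ht0]
    | succ n ih =>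
      obtain ⟨c, hcn⟩ := ht n
      have hle : (t n : ℝ) ≤ t (n + 1) := htmono n.le_succ
      have hstep := length_add_volume_columnSlice_le_of_segment hD hDQ hle (c := c)
        fun x hx => hcn (a := ⟨x, (t n).2.1.trans hx.1, hx.2.trans (t (n + 1)).2.2⟩) hx
      have hadd := hausdorffMeasure_quadrantFrontier_add_le (D := D)
        (I := Ioc s (t n)) (J := Ioc (t n) (t (n + 1))) (K := Ioc s (t (n + 1)))
        measurableSet_Ioc (Ioc_disjoint_Ioc_of_le le_rfl) (Ioc_subset_Ioc_right hle)
        (Ioc_subset_Ioc_left (t n).2.1)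
      calc _ = ENNReal.ofReal (t (n + 1) - t n) +
            (ENNReal.ofReal (t n - s) + volume (columnSlice D s)) := by
            rw [← add_assoc, ← ENNReal.ofReal_add (sub_nonneg.2 hle) (sub_nonneg.2 (t n).2.1),
              sub_add_sub_cancel]
        _ ≤ _ := add_le_add le_rfl ih
        _ = (ENNReal.ofReal (t (n + 1) - t n) + volume (columnSlice D (t n))) +
            NNReal.sqrt 2 * μH[1] (quadrantFrontier D ∩ {z | z 0 ∈ Ioc s (t n : ℝ)}) := by
            rw [add_assoc]
        _ ≤ _ := add_le_add hstep le_rfl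
        _ = volume (columnSlice D (t (n + 1))) + NNReal.sqrt 2 *
            (μH[1] (quadrantFrontier D ∩ {z | z 0 ∈ Ioc s (t n : ℝ)}) +
              μH[1] (quadrantFrontier D ∩ {z | z 0 ∈ Ioc (t n : ℝ) (t (n + 1))})) := by ring
        _ ≤ _ := by gcongr
  simpa [hm m le_rfl] using key m

variable {A B : ℝ}

/-- Vertical projection estimate: every column meeting a bounded set `D` meets its frontier. -/
lemma volume_le_of_columnSlice_nonempty (hD : IsOpen D)
    (hDQ : D ⊆ {z | 0 < z 0 ∧ 0 < z 1}) (hDB : D ⊆ {z | z 0 < A ∧ z 1 < B}) {W : Set ℝ}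
    (hW : ∀ x ∈ W, (columnSlice D x).Nonempty) :
    volume W ≤ μH[1] (quadrantFrontier D ∩ {z | z 0 ∈ W}) := by
  refine volume_le_hausdorffMeasure_of_coord 0 fun x hx => ?_
  obtain ⟨y, hy⟩ := hW x hx
  have hpos := hDQ hy
  have hlt := hDB hy
  simp only [mem_ofPred_eq, Matrix.cons_val_zero, Matrix.cons_val_one] at hpos hlt
  obtain ⟨t, ht, htf⟩ := exists_mem_frontier_of_path hD
    (by fun_prop : Continuous fun t : ℝ => (!₂[x, t] : EuclideanSpace ℝ (Fin 2))) hlt.2.le hy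
    fun h => lt_irrefl B (by simpa using (hDB h).2)
  exact ⟨_, ⟨⟨⟨hpos.1, hpos.2.trans ht.1⟩, htf⟩, hx⟩, rfl⟩

lemma volume_columnSlice_le (hD : IsOpen D)
    (hDQ : D ⊆ {z | 0 < z 0 ∧ 0 < z 1}) (hDB : D ⊆ {z | z 0 < A ∧ z 1 < B}) {s : ℝ} :
    volume (columnSlice D s) ≤ μH[1] (quadrantFrontier D ∩ {z | z 0 ∈ Ioi s}) := by
  have hempty : columnSlice D (max s A) = ∅ := by
    refine eq_empty_of_forall_notMem fun y hy => ?_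
    have := (hDB hy).1
    simp at this
  have := volume_columnSlice_inter_le hD hDQ (le_max_left s A) univ
  rw [hempty] at this
  simp only [inter_univ, measure_empty, zero_add, mem_univ, and_true] at this
  exact this.trans (measure_mono (inter_subset_inter_right _ fun z hz => hz.1))

lemma volume_columnSlice_add_offset_le (hD : IsOpen D)
    (hDQ : D ⊆ {z | 0 < z 0 ∧ 0 < z 1}) (hDB : D ⊆ {z | z 0 < A ∧ z 1 < B}) {x₀ x₁ : ℝ}
    (hx : ∀ x ∈ Ioo x₀ x₁, (columnSlice D x).Nonempty) {s : ℝ} (hs : s ∈ Ioo x₀ x₁) :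
    volume (columnSlice D s) + ENNReal.ofReal (s - x₀) ≤ μH[1] (quadrantFrontier D) := by
  have h₁ := volume_le_of_columnSlice_nonempty hD hDQ hDB (W := Ioo x₀ s)
    fun x h => hx x ⟨h.1, h.2.trans hs.2⟩
  rw [Real.volume_Ioo] at h₁
  have h₂ := hausdorffMeasure_quadrantFrontier_add_le (D := D) (I := Ioi s) (J := Ioo x₀ s)
    (K := univ) measurableSet_Ioo
    (Set.disjoint_left.2 fun x hx hx' => lt_asymm hx hx'.2) (subset_univ _) (subset_univ _)
  simp only [mem_univ, ofPred_true, inter_univ] at h₂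
  exact (add_le_add (volume_columnSlice_le hD hDQ hDB) h₁).trans h₂

lemma volume_columnSlice_add_width_le (hD : IsOpen D)
    (hDQ : D ⊆ {z | 0 < z 0 ∧ 0 < z 1}) (hDB : D ⊆ {z | z 0 < A ∧ z 1 < B}) {x₀ x₁ : ℝ}
    (hx : ∀ x ∈ Ioo x₀ x₁, (columnSlice D x).Nonempty) {s : ℝ} (hs : s ∈ Ioo x₀ x₁) :
    volume (columnSlice D s) + ENNReal.ofReal (x₁ - x₀) ≤
      NNReal.sqrt 2 * μH[1] (quadrantFrontier D) := by
  have hone : (1 : ℝ≥0∞) ≤ NNReal.sqrt 2 := by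
    rw [ENNReal.one_le_coe_iff, NNReal.one_le_sqrt]
    exact one_le_two
  have hleft : ENNReal.ofReal (s - x₀) ≤
      NNReal.sqrt 2 * μH[1] (quadrantFrontier D ∩ {z | z 0 ∈ Iic s}) := by
    rw [← Real.volume_Ioo]
    calc _ ≤ _ := volume_le_of_columnSlice_nonempty hD hDQ hDB
          fun x h => hx x ⟨h.1, h.2.trans hs.2⟩
      _ ≤ μH[1] (quadrantFrontier D ∩ {z | z 0 ∈ Iic s}) :=
          measure_mono (inter_subset_inter_right _ fun z hz => hz.2.le)
      _ ≤ _ := le_mul_of_one_le_left zero_le hone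
  have hright (e : ℝ) (he : e ∈ Ioo s x₁) :
      ENNReal.ofReal (e - s) + volume (columnSlice D s) ≤
        NNReal.sqrt 2 * μH[1] (quadrantFrontier D ∩ {z | z 0 ∈ Ioi s}) := by
    calc _ ≤ _ := length_add_volume_columnSlice_le hD hDQ he.1.le
          fun x h => hx x ⟨hs.1.trans_le h.1, h.2.trans_lt he.2⟩
      _ ≤ NNReal.sqrt 2 * μH[1] (quadrantFrontier D ∩ {z | z 0 ∈ Ioi e}) +
          NNReal.sqrt 2 * μH[1] (quadrantFrontier D ∩ {z | z 0 ∈ Ioc s e}) :=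
          add_le_add ((volume_columnSlice_le hD hDQ hDB).trans
            (le_mul_of_one_le_left zero_le hone)) le_rfl
      _ ≤ _ := by
          rw [← mul_add]
          gcongr
          exact hausdorffMeasure_quadrantFrontier_add_le measurableSet_Ioc
            (Set.disjoint_left.2 fun x hx hx' => not_lt_of_ge hx'.2 hx)
            (Ioi_subset_Ioi he.1.le) Ioc_subset_Ioi_self
  have hall := hausdorffMeasure_quadrantFrontier_add_le (D := D) (I := Iic s) (J := Ioi s)
    (K := univ) measurableSet_Ioi
    (Set.disjoint_left.2 fun x hx hx' => not_lt_of_ge (mem_Iic.1 hx) hx') (subset_univ _)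
    (subset_univ _)
  simp only [mem_univ, ofPred_true, inter_univ] at hall
  have hlim : Filter.Tendsto (fun e => volume (columnSlice D s) + ENNReal.ofReal (e - x₀))
      (nhdsWithin x₁ (Iio x₁)) (nhds (volume (columnSlice D s) + ENNReal.ofReal (x₁ - x₀))) := by
    refine Filter.Tendsto.mono_left (Continuous.tendsto ?_ x₁) nhdsWithin_le_nhds
    exact continuous_const.add (ENNReal.continuous_ofReal.comp (by fun_prop))
  refine le_of_tendsto hlim ?_
  filter_upwards [Ioo_mem_nhdsLT hs.2] with e he
  calc volume (columnSlice D s) + ENNReal.ofReal (e - x₀)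
      = ENNReal.ofReal (s - x₀) + (ENNReal.ofReal (e - s) + volume (columnSlice D s)) := by
        rw [← add_assoc, ← ENNReal.ofReal_add (sub_nonneg.2 hs.1.le) (sub_nonneg.2 he.1.le),
          add_comm, add_comm (s - x₀), sub_add_sub_cancel]
    _ ≤ _ := add_le_add hleft (hright e he)
    _ ≤ _ := by
        rw [← mul_add]
        gcongr

end Quadrant

/-! ### The isoperimetric estimate in the quadrant -/

lemma lintegral_Ioo_le_of_le_ofReal {x₀ x₁ H : ℝ} (hx : x₀ ≤ x₁) (hH : x₁ - x₀ ≤ H)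
    {g : ℝ → ℝ≥0∞}
    (hg₁ : ∀ s ∈ Ioo x₀ x₁, g s ≤ ENNReal.ofReal (√2 * H - (x₁ - x₀)))
    (hg₂ : ∀ s ∈ Ioo x₀ x₁, g s ≤ ENNReal.ofReal (H - (s - x₀))) :
    ∫⁻ s in Ioo x₀ x₁, g s ≤ ENNReal.ofReal ((√2 - 1) * H ^ 2) := by
  have h2 : √2 * √2 = 2 := Real.mul_self_sqrt zero_le_two
  have h1 : 1 < √2 := Real.one_lt_sqrt_two
  have hH0 : 0 ≤ H := (sub_nonneg.2 hx).trans hH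
  have hnn : 0 ≤ √2 * H - (x₁ - x₀) := by nlinarith
  set q := x₁ - x₀ with hq
  have hq0 : 0 ≤ q := sub_nonneg.2 hx
  rcases le_total q ((√2 - 1) * H) with hqH | hqH
  · calc ∫⁻ s in Ioo x₀ x₁, g s ≤ ∫⁻ _ in Ioo x₀ x₁, ENNReal.ofReal (√2 * H - q) :=
          setLIntegral_mono measurable_const hg₁
      _ = ENNReal.ofReal ((√2 * H - q) * q) := by
          rw [setLIntegral_const, Real.volume_Ioo, ENNReal.ofReal_mul hnn]
      _ ≤ _ := by
          refine ENNReal.ofReal_le_ofReal ?_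
          nlinarith [mul_nonneg (sub_nonneg.2 hqH) (sub_nonneg.2 hH)]
  · set m := x₁ - (√2 - 1) * H with hm
    have hm₀ : x₀ ≤ m := by linarith
    have hm₁ : m ≤ x₁ := by nlinarith
    have hint : ∫⁻ s in Ioo m x₁, ENNReal.ofReal (H - (s - x₀)) =
        ENNReal.ofReal (H * (x₁ - m) - ((x₁ - x₀) ^ 2 - (m - x₀) ^ 2) / 2) := by
      have hcont : Continuous fun s : ℝ => H - (s - x₀) := by fun_prop
      rw [← ofReal_integral_eq_lintegral_ofReal, ← integral_Ioc_eq_integral_Ioo,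
        ← intervalIntegral.integral_of_le hm₁]
      · congr 1
        rw [intervalIntegral.integral_sub (by simp) ((by fun_prop : Continuous
          fun s : ℝ => s - x₀).intervalIntegrable _ _), intervalIntegral.integral_comp_sub_right
          (fun s => s), integral_id, intervalIntegral.integral_const, smul_eq_mul]
        ring
      · exact (hcont.integrableOn_Icc (a := m) (b := x₁)).mono_set Ioo_subset_Icc_self
      · refine (ae_restrict_iff' measurableSet_Ioo).2 (Filter.Eventually.of_forall fun s hs => ?_)
        change 0 ≤ H - (s - x₀)
        linarith [hs.2]
    calc ∫⁻ s in Ioo x₀ x₁, g s ≤ ∫⁻ s in (Ioc x₀ m ∩ Ioo x₀ x₁) ∪ Ioo m x₁, g s := by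
          refine lintegral_mono_set fun s hs => ?_
          rcases le_or_gt s m with h | h
          · exact Or.inl ⟨⟨hs.1, h⟩, hs⟩
          · exact Or.inr ⟨h, hs.2⟩
      _ ≤ (∫⁻ s in Ioc x₀ m ∩ Ioo x₀ x₁, g s) + ∫⁻ s in Ioo m x₁, g s := lintegral_union_le _ _ _
      _ ≤ (∫⁻ _ in Ioc x₀ m ∩ Ioo x₀ x₁, ENNReal.ofReal (√2 * H - q)) +
          ∫⁻ s in Ioo m x₁, ENNReal.ofReal (H - (s - x₀)) :=
          add_le_add (setLIntegral_mono measurable_const fun s hs => hg₁ s hs.2)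
            (setLIntegral_mono (by fun_prop) fun s hs => hg₂ s ⟨hm₀.trans_lt hs.1, hs.2⟩)
      _ ≤ ENNReal.ofReal ((√2 * H - q) * (m - x₀)) +
          ENNReal.ofReal (H * (x₁ - m) - ((x₁ - x₀) ^ 2 - (m - x₀) ^ 2) / 2) := by
          rw [hint, setLIntegral_const, ENNReal.ofReal_mul hnn]
          gcongr
          rw [← Real.volume_Ioc]
          exact measure_mono inter_subset_left
      _ ≤ _ := by
          rw [← ENNReal.ofReal_add (mul_nonneg hnn (sub_nonneg.2 hm₀))]
          · refine ENNReal.ofReal_le_ofReal ?_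
            have e1 : x₁ - m = (√2 - 1) * H := by rw [hm]; ring
            have e2 : m - x₀ = q - (√2 - 1) * H := by rw [hm, hq]; ring
            rw [e1, e2, ← hq]
            have h3 : (√2 * H) ^ 2 = 2 * H ^ 2 := by rw [mul_pow, sq √2, h2]
            nlinarith [sq_nonneg (2 * q - √2 * H)]
          · nlinarith

lemma volume_le_mul_sq_hausdorffMeasure_quadrantFrontier
    {D : Set (EuclideanSpace ℝ (Fin 2))} (hD : IsOpen D) (hDc : IsConnected D)
    (hDQ : D ⊆ {z | 0 < z 0 ∧ 0 < z 1}) {A B : ℝ} (hDB : D ⊆ {z | z 0 < A ∧ z 1 < B}) :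
    volume D ≤ ENNReal.ofReal (√2 - 1) * μH[1] (quadrantFrontier D) ^ 2 := by
  have hβ : 0 < √2 - 1 := sub_pos.2 Real.one_lt_sqrt_two
  by_cases hfin : μH[1] (quadrantFrontier D) = ⊤
  · rw [hfin, ENNReal.top_pow two_ne_zero, ENNReal.mul_top (ENNReal.ofReal_pos.2 hβ).ne']
    exact le_top
  set O : Set ℝ := (fun z : EuclideanSpace ℝ (Fin 2) => z 0) '' D
  have hOc : IsConnected O := hDc.image _ (by fun_prop)
  have hbelow : BddBelow O := ⟨0, by rintro _ ⟨z, hz, rfl⟩; exact (hDQ hz).1.le⟩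
  have habove : BddAbove O := ⟨A, by rintro _ ⟨z, hz, rfl⟩; exact (hDB hz).1.le⟩
  have hIoo := hOc.Ioo_csInf_csSup_subset hbelow habove
  set x₀ := sInf O
  set x₁ := sSup O
  have hx₀₁ : x₀ ≤ x₁ := csInf_le_csSup hOc.nonempty hbelow habove
  have hne : ∀ x ∈ Ioo x₀ x₁, (columnSlice D x).Nonempty := fun x hx => by
    obtain ⟨z, hz, rfl⟩ := hIoo hx
    have hz' : !₂[z 0, z 1] = z := by
      ext i
      fin_cases i <;> rfl
    exact ⟨z 1, by rwa [mem_columnSlice, hz']⟩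
  have hzero : ∀ s ∉ Icc x₀ x₁, volume (columnSlice D s) = 0 := fun s hs => by
    rw [eq_empty_of_forall_notMem (s := columnSlice D s), measure_empty]
    intro y hy
    have : s ∈ O := ⟨_, hy, rfl⟩
    exact hs ⟨csInf_le hbelow this, le_csSup habove this⟩
  have hvol : volume D = ∫⁻ s in Ioo x₀ x₁, volume (columnSlice D s) := by
    rw [volume_eq_lintegral_columnSlice hD, setLIntegral_congr Ioo_ae_eq_Icc,
      ← lintegral_indicator measurableSet_Icc]
    refine lintegral_congr fun s => ?_
    by_cases hs : s ∈ Icc x₀ x₁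
    · rw [indicator_of_mem hs]
    · rw [indicator_of_notMem hs, hzero s hs]
  have hH := ENNReal.ofReal_toReal hfin
  set H := (μH[1] (quadrantFrontier D)).toReal
  have hsqrt : ((NNReal.sqrt 2 : NNReal) : ℝ≥0∞) = ENNReal.ofReal √2 := by
    rw [← ENNReal.ofReal_coe_nnreal, Real.coe_sqrt, NNReal.coe_ofNat]
  have hqH : x₁ - x₀ ≤ H := by
    rw [← ENNReal.ofReal_le_ofReal_iff ENNReal.toReal_nonneg, hH, ← Real.volume_Ioo]
    exact (volume_le_of_columnSlice_nonempty hD hDQ hDB hne).trans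
      (measure_mono inter_subset_left)
  rw [hvol, ← hH, ← ENNReal.ofReal_pow ENNReal.toReal_nonneg, ← ENNReal.ofReal_mul hβ.le]
  refine lintegral_Ioo_le_of_le_ofReal hx₀₁ hqH (fun s hs => ?_) (fun s hs => ?_)
  · rw [ENNReal.ofReal_sub _ (sub_nonneg.2 hx₀₁), ENNReal.ofReal_mul (Real.sqrt_nonneg 2), hH,
      ← hsqrt]
    exact ENNReal.le_sub_of_add_le_right ENNReal.ofReal_ne_top
      (volume_columnSlice_add_width_le hD hDQ hDB hne hs)
  · rw [ENNReal.ofReal_sub _ (sub_nonneg.2 hs.1.le), hH]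
    exact ENNReal.le_sub_of_add_le_right ENNReal.ofReal_ne_top
      (volume_columnSlice_add_offset_le hD hDQ hDB hne hs)

/-! ### Cuts of a rectangle -/

/-- The open rectangle `(0, a) × (0, b)`. -/
def openRectangle (a b : ℝ) : Set (EuclideanSpace ℝ (Fin 2)) :=
  {x | 0 < x 0 ∧ x 0 < a ∧ 0 < x 1 ∧ x 1 < b}

/-- The reflection `t ↦ c - t` of the `i`-th coordinate. -/
noncomputable def coordReflection (i : Fin 2) (c : ℝ) :
    EuclideanSpace ℝ (Fin 2) ≃ᵢ EuclideanSpace ℝ (Fin 2) :=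
  IsometryEquiv.mk' (fun z => WithLp.toLp 2 fun j => if j = i then c - z j else z j)
    (fun z => WithLp.toLp 2 fun j => if j = i then c - z j else z j)
    (fun z => by ext j; by_cases h : j = i <;> simp [h])
    (Isometry.of_dist_eq fun x y => by
      rw [EuclideanSpace.dist_eq, EuclideanSpace.dist_eq]
      congr 1
      refine Finset.sum_congr rfl fun j _ => ?_
      by_cases h : j = i <;> simp only [h, if_true, if_false, dist_sub_left])

lemma coordReflection_apply (i : Fin 2) (c : ℝ) (z : EuclideanSpace ℝ (Fin 2)) (j : Fin 2) :
    coordReflection i c z j = if j = i then c - z j else z j := rfl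

lemma measurePreserving_coordReflection (i : Fin 2) (c : ℝ) :
    MeasurePreserving (coordReflection i c) := by
  have hpi : MeasurePreserving fun (x : Fin 2 → ℝ) j => (if j = i then (c - ·) else id) (x j) :=
    volume_preserving_pi fun j => by
      by_cases h : j = i
      · simpa [h] using Measure.measurePreserving_sub_left volume c
      · simpa [h] using MeasurePreserving.id volume
  convert (PiLp.volume_preserving_toLp (Fin 2)).comp
    (hpi.comp (PiLp.volume_preserving_ofLp (Fin 2))) using 1
  ext z j
  by_cases h : j = i <;> simp [h, coordReflection_apply]

lemma coordReflection_zero_preimage_openRectangle (a b : ℝ) :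
    coordReflection 0 a ⁻¹' openRectangle a b = openRectangle a b := by
  ext z
  simp only [openRectangle, mem_preimage, mem_ofPred_eq, coordReflection_apply, if_true,
    one_ne_zero, if_false, sub_pos, sub_lt_self_iff]
  tauto

lemma coordReflection_one_preimage_openRectangle (a b : ℝ) :
    coordReflection 1 b ⁻¹' openRectangle a b = openRectangle a b := by
  ext z
  simp only [openRectangle, mem_preimage, mem_ofPred_eq, coordReflection_apply, if_true,
    zero_ne_one, if_false, sub_pos, sub_lt_self_iff]
  tauto

section Rectangle

variable {a b ξ η : ℝ} {D : Set (EuclideanSpace ℝ (Fin 2))}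

/-- The estimate `vol(D) ≤ (√2 - 1) ℋ¹(R ∩ ∂D)²` is invariant under symmetries of `R`. -/
lemma volume_le_of_preimage_coordReflection {i : Fin 2} {c : ℝ} {C : ℝ≥0∞}
    {R : Set (EuclideanSpace ℝ (Fin 2))} (hR : coordReflection i c ⁻¹' R = R) (hD : IsOpen D)
    (h : volume (coordReflection i c ⁻¹' D) ≤
      C * μH[1] (R ∩ frontier (coordReflection i c ⁻¹' D)) ^ 2) :
    volume D ≤ C * μH[1] (R ∩ frontier D) ^ 2 := by
  have hfr := (coordReflection i c).toHomeomorph.preimage_frontier D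
  rw [IsometryEquiv.coe_toHomeomorph] at hfr
  have hcut : R ∩ frontier (coordReflection i c ⁻¹' D) =
      coordReflection i c ⁻¹' (R ∩ frontier D) := by
    rw [preimage_inter, hR, hfr]
  rwa [(measurePreserving_coordReflection i c).measure_preimage
    hD.measurableSet.nullMeasurableSet, hcut, IsometryEquiv.hausdorffMeasure_preimage] at h

lemma volume_le_of_subset_corner (hD : IsOpen D) (hDc : IsConnected D)
    (hDR : D ⊆ openRectangle a b) (hξ : ξ < a) (hη : η < b) (hDξ : ∀ z ∈ D, z 0 < ξ)
    (hDη : ∀ z ∈ D, z 1 < η) :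
    volume D ≤ ENNReal.ofReal (√2 - 1) * μH[1] (openRectangle a b ∩ frontier D) ^ 2 := by
  refine (volume_le_mul_sq_hausdorffMeasure_quadrantFrontier hD hDc
    (fun z hz => ⟨(hDR hz).1, (hDR hz).2.2.1⟩)
    (fun z hz => ⟨hDξ z hz, hDη z hz⟩ : D ⊆ {z | z 0 < ξ ∧ z 1 < η})).trans ?_
  gcongr
  rintro z ⟨hz, hzf⟩
  have hcl (i : Fin 2) (d : ℝ) (h : ∀ z ∈ D, z i < d) : z i ≤ d :=
    closure_minimal (fun z hz => (h z hz).le : D ⊆ {z | z i ≤ d})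
      (isClosed_le (by fun_prop : Continuous fun z : EuclideanSpace ℝ (Fin 2) => z i)
        continuous_const) (frontier_subset_closure hzf)
  exact ⟨⟨hz.1, (hcl 0 ξ hDξ).trans_lt hξ, hz.2, (hcl 1 η hDη).trans_lt hη⟩, hzf⟩

lemma forall_lt_or_forall_gt_of_ne (hDc : IsConnected D) (i : Fin 2) {c : ℝ}
    (h : ∀ z ∈ D, z i ≠ c) : (∀ z ∈ D, z i < c) ∨ ∀ z ∈ D, c < z i := by
  have hcont : Continuous fun z : EuclideanSpace ℝ (Fin 2) => z i := by fun_prop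
  have hlt : IsOpen {z : EuclideanSpace ℝ (Fin 2) | z i < c} := isOpen_lt hcont continuous_const
  have hgt : IsOpen {z : EuclideanSpace ℝ (Fin 2) | c < z i} := isOpen_lt continuous_const hcont
  exact IsPreconnected.subset_or_subset hlt hgt
    (Set.disjoint_left.2 fun z (hz : z i < c) (hz' : c < z i) => lt_asymm hz hz')
    (fun z hz => lt_or_gt_of_ne (h z hz)) hDc.isPreconnected

lemma volume_le_of_left_of_avoids_row (hD : IsOpen D) (hDc : IsConnected D)
    (hDR : D ⊆ openRectangle a b) (hξ : ξ < a) (hη : η ∈ Ioo 0 b) (hDξ : ∀ z ∈ D, z 0 < ξ)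
    (hDη : ∀ z ∈ D, z 1 ≠ η) :
    volume D ≤ ENNReal.ofReal (√2 - 1) * μH[1] (openRectangle a b ∩ frontier D) ^ 2 := by
  rcases forall_lt_or_forall_gt_of_ne hDc 1 hDη with h | h
  · exact volume_le_of_subset_corner hD hDc hDR hξ hη.2 hDξ h
  · have hR := coordReflection_one_preimage_openRectangle a b
    refine volume_le_of_preimage_coordReflection hR hD (volume_le_of_subset_corner
      (hD.preimage (coordReflection 1 b).continuous)
      ((coordReflection 1 b).toHomeomorph.isConnected_preimage.2 hDc)
      ((preimage_mono hDR).trans hR.subset) hξ (sub_lt_self b hη.1) (fun z hz => ?_)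
      (fun z hz => ?_))
    · simpa [coordReflection_apply] using hDξ _ hz
    · have := h _ hz
      simp only [coordReflection_apply, if_true] at this
      linarith

lemma volume_le_of_avoids_row_column (hD : IsOpen D) (hDc : IsConnected D)
    (hDR : D ⊆ openRectangle a b) (hξ : ξ ∈ Ioo 0 a) (hη : η ∈ Ioo 0 b)
    (hDξ : ∀ z ∈ D, z 0 ≠ ξ) (hDη : ∀ z ∈ D, z 1 ≠ η) :
    volume D ≤ ENNReal.ofReal (√2 - 1) * μH[1] (openRectangle a b ∩ frontier D) ^ 2 := by
  rcases forall_lt_or_forall_gt_of_ne hDc 0 hDξ with h | h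
  · exact volume_le_of_left_of_avoids_row hD hDc hDR hξ.2 hη h hDη
  · have hR := coordReflection_zero_preimage_openRectangle a b
    refine volume_le_of_preimage_coordReflection hR hD (volume_le_of_left_of_avoids_row
      (hD.preimage (coordReflection 0 a).continuous)
      ((coordReflection 0 a).toHomeomorph.isConnected_preimage.2 hDc)
      ((preimage_mono hDR).trans hR.subset) (sub_lt_self a hξ.1) hη (fun z hz => ?_)
      (fun z hz => ?_))
    · have := h _ hz
      simp only [coordReflection_apply, if_true] at this
      linarith
    · simpa [coordReflection_apply] using hDη _ hz

lemma volume_openRectangle (ha : 0 < a) :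
    volume (openRectangle a b) = ENNReal.ofReal (a * b) := by
  have hpre : (fun p : ℝ × ℝ => (!₂[p.1, p.2] : EuclideanSpace ℝ (Fin 2))) ⁻¹' openRectangle a b =
      Ioo 0 a ×ˢ Ioo 0 b := by
    ext p
    simp [openRectangle, and_assoc]
  have hmeas : MeasurableSet (openRectangle a b) := by
    have : openRectangle a b = {z | z 0 ∈ Ioo 0 a} ∩ {z | z 1 ∈ Ioo 0 b} := by
      ext z
      simp [openRectangle, and_assoc]
    rw [this]
    exact (measurableSet_coord_mem 0 measurableSet_Ioo).inter
      (measurableSet_coord_mem 1 measurableSet_Ioo)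
  rw [← measurePreserving_toLp_pair.measure_preimage hmeas.nullMeasurableSet, hpre,
    Measure.volume_eq_prod, Measure.prod_prod, Real.volume_Ioo, Real.volume_Ioo, sub_zero, sub_zero,
    ENNReal.ofReal_mul ha.le]

lemma isOpen_openRectangle : IsOpen (openRectangle a b) := by
  have hc (i : Fin 2) : Continuous fun z : EuclideanSpace ℝ (Fin 2) => z i := by fun_prop
  exact (isOpen_lt continuous_const (hc 0)).inter ((isOpen_lt (hc 0) continuous_const).inter
    ((isOpen_lt continuous_const (hc 1)).inter (isOpen_lt (hc 1) continuous_const)))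

lemma isPreconnected_openRectangle_inter_line (i : Fin 2) (c : ℝ) :
    IsPreconnected (openRectangle a b ∩ {z | z i = c}) := by
  have hproj (j : Fin 2) {I : Set ℝ} (hI : Convex ℝ I) :
      Convex ℝ {z : EuclideanSpace ℝ (Fin 2) | z j ∈ I} :=
    hI.linear_preimage (EuclideanSpace.proj (𝕜 := ℝ) j).toLinearMap
  have : openRectangle a b ∩ {z | z i = c} =
      ({z | z 0 ∈ Ioo 0 a} ∩ {z | z 1 ∈ Ioo 0 b}) ∩ {z | z i ∈ ({c} : Set ℝ)} := by
    ext z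
    simp [openRectangle, and_assoc]
  rw [this]
  exact (((hproj 0 (convex_Ioo 0 a)).inter (hproj 1 (convex_Ioo 0 b))).inter
    (hproj i (convex_singleton c))).isPreconnected

/-- A cut `R ∩ ∂S` either projects onto a full side of the rectangle, or it misses a row and a
column, and then one of the two parts satisfies the isoperimetric estimate. -/
lemma cut_alternatives {S : Set (EuclideanSpace ℝ (Fin 2))} (hSopen : IsOpen S)
    (hSconn : IsConnected S) (hSR : S ⊆ openRectangle a b)
    (hTconn : IsConnected (openRectangle a b \ closure S)) :
    ENNReal.ofReal b ≤ μH[1] (openRectangle a b ∩ frontier S) ∨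
    ENNReal.ofReal a ≤ μH[1] (openRectangle a b ∩ frontier S) ∨
    volume S ≤ ENNReal.ofReal (√2 - 1) * μH[1] (openRectangle a b ∩ frontier S) ^ 2 ∨
    volume (openRectangle a b \ closure S) ≤
      ENNReal.ofReal (√2 - 1) * μH[1] (openRectangle a b ∩ frontier S) ^ 2 := by
  set R := openRectangle a b with hR
  set T := R \ closure S with hT
  have hTopen : IsOpen T := isOpen_openRectangle.sdiff isClosed_closure
  have hdisj : Disjoint S T :=
    Set.disjoint_left.2 fun z hz hz' => hz'.2 (subset_closure hz)
  by_cases hrow : ∀ η ∈ Ioo 0 b, ∃ z ∈ R ∩ frontier S, z 1 = η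
  · left
    simpa using volume_le_hausdorffMeasure_of_coord 1 hrow
  by_cases hcol : ∀ ξ ∈ Ioo 0 a, ∃ z ∈ R ∩ frontier S, z 0 = ξ
  · right; left
    simpa using volume_le_hausdorffMeasure_of_coord 0 hcol
  push Not at hrow hcol
  obtain ⟨η, hη, hrow⟩ := hrow
  obtain ⟨ξ, hξ, hcol⟩ := hcol
  have hcover (i : Fin 2) (c : ℝ) (h : ∀ z ∈ R ∩ frontier S, z i ≠ c) :
      R ∩ {z | z i = c} ⊆ S ∪ T := fun z hz => by
    by_cases hzS : z ∈ S
    · exact Or.inl hzS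
    · refine Or.inr ⟨hz.1, fun hcl => h z ⟨hz.1, ?_⟩ hz.2⟩
      rw [hSopen.frontier_eq]
      exact ⟨hcl, hzS⟩
  have hpR : !₂[ξ, η] ∈ R := by simpa [hR, openRectangle, and_assoc] using And.intro hξ hη
  have hp0 : !₂[ξ, η] ∈ R ∩ {z | z 0 = ξ} := ⟨hpR, rfl⟩
  have hp1 : !₂[ξ, η] ∈ R ∩ {z | z 1 = η} := ⟨hpR, rfl⟩
  right; right
  rcases hcover 0 ξ hcol hp0 with hp | hp
  · right
    have h0 := (isPreconnected_openRectangle_inter_line 0 ξ).subset_left_of_subset_union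
      hSopen hTopen hdisj (hcover 0 ξ hcol) ⟨_, hp0, hp⟩
    have h1 := (isPreconnected_openRectangle_inter_line 1 η).subset_left_of_subset_union
      hSopen hTopen hdisj (hcover 1 η hrow) ⟨_, hp1, hp⟩
    have hsub : R ∩ frontier T ⊆ R ∩ frontier S := by
      rintro z ⟨hzR, hzf⟩
      refine ⟨hzR, ?_⟩
      rw [hTopen.frontier_eq] at hzf
      have hzS : z ∈ closure S := by_contra fun h => hzf.2 ⟨hzR, h⟩
      rw [hSopen.frontier_eq]
      exact ⟨hzS, fun h => Set.disjoint_left.1 (hdisj.closure_right hSopen) h hzf.1⟩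
    refine (volume_le_of_avoids_row_column hTopen hTconn sdiff_subset hξ hη
      (fun z hz hzξ => Set.disjoint_left.1 hdisj (h0 ⟨hz.1, hzξ⟩) hz)
      (fun z hz hzη => Set.disjoint_left.1 hdisj (h1 ⟨hz.1, hzη⟩) hz)).trans ?_
    exact mul_le_mul_right (pow_le_pow_left' (measure_mono hsub) 2) _
  · left
    have h0 := (isPreconnected_openRectangle_inter_line 0 ξ).subset_right_of_subset_union
      hSopen hTopen hdisj (hcover 0 ξ hcol) ⟨_, hp0, hp⟩
    have h1 := (isPreconnected_openRectangle_inter_line 1 η).subset_right_of_subset_union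
      hSopen hTopen hdisj (hcover 1 η hrow) ⟨_, hp1, hp⟩
    exact volume_le_of_avoids_row_column hSopen hSconn hSR hξ hη
      (fun z hz hzξ => Set.disjoint_left.1 hdisj hz (h0 ⟨hSR hz, hzξ⟩))
      (fun z hz hzη => Set.disjoint_left.1 hdisj hz (h1 ⟨hSR hz, hzη⟩))

end Rectangle

/-- The isoperimetric estimate `t ≤ (√2 - 1) h²` suffices for the Ratio Cut bound, since
`16 · 4 / 27 ≤ √2 + 1`. -/
lemma four_mul_le_of_le_mul_sq {a b h t : ℝ} (hb : 0 < b) (hba : b < a) (hh : 0 ≤ h) (ht : 0 ≤ t)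
    (htab : t ≤ a * b) (hth : t ≤ (√2 - 1) * h ^ 2) :
    4 * (t * (a * b - t)) ≤ a * (h * (a * b)) := by
  have ha : 0 < a := hb.trans hba
  have h2 : √2 * √2 = 2 := Real.mul_self_sqrt zero_le_two
  have h1 : (1.4 : ℝ) ≤ √2 := Real.le_sqrt_of_sq_le (by norm_num)
  have hh2 : 2.4 * t ≤ h ^ 2 := by nlinarith [sq_nonneg h]
  refine abs_le_of_sq_le_sq' ?_ (by positivity) |>.2
  have hcubic : 27 * (t * (a * b - t) ^ 2) ≤ 4 * (a * b) ^ 3 := by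
    nlinarith [mul_nonneg (sq_nonneg (a * b - 3 * t)) (by linarith : 0 ≤ 4 * (a * b) - 3 * t)]
  have hab : (a * b) ^ 3 ≤ a ^ 2 * (a * b) ^ 2 := by
    have : a * b ≤ a ^ 2 := by nlinarith
    calc (a * b) ^ 3 = (a * b) * (a * b) ^ 2 := by ring
      _ ≤ _ := by gcongr
  calc (4 * (t * (a * b - t))) ^ 2 = 16 * t * (t * (a * b - t) ^ 2) := by ring
    _ ≤ 16 * t * (4 / 27 * (a ^ 2 * (a * b) ^ 2)) :=
      mul_le_mul_of_nonneg_left (by linarith) (by positivity)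
    _ = 64 / 27 * t * (a ^ 2 * (a * b) ^ 2) := by ring
    _ ≤ h ^ 2 * (a ^ 2 * (a * b) ^ 2) :=
      mul_le_mul_of_nonneg_right (by linarith) (by positivity)
    _ = _ := by ring

/-- Lemma 1, lower-bound part: every admissible cut of the open rectangle
`R = (0,a) × (0,b)` (with `0 < b < a`) into a nonempty open connected subset `S`
and a nonempty connected complement `T = R \ closure S`, separated by
`Γ = R ∩ frontier S`, has Ratio Cut value at least `4/a`:
`ℋ¹(Γ) · vol(R) ≥ (4/a) · vol(S) · vol(T)`. -/
theorem ratio_cut_rectangle_lower_bound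
    (a b : ℝ) (hb : 0 < b) (hba : b < a)
    (R S : Set (EuclideanSpace ℝ (Fin 2)))
    (hR : R = {x : EuclideanSpace ℝ (Fin 2) | 0 < x 0 ∧ x 0 < a ∧ 0 < x 1 ∧ x 1 < b})
    (hSopen : IsOpen S) (hSconn : IsConnected S) (hSR : S ⊆ R)
    (hTne : (R \ closure S).Nonempty) (hTconn : IsConnected (R \ closure S)) :
    μH[1] (R ∩ frontier S) * volume R ≥
      ENNReal.ofReal (4 / a) * (volume S * volume (R \ closure S)) := by
  have ha : 0 < a := hb.trans hba
  have hab : 0 < a * b := mul_pos ha hb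
  obtain rfl : R = openRectangle a b := hR
  have hvol : volume (openRectangle a b) = ENNReal.ofReal (a * b) := volume_openRectangle ha
  have halt := cut_alternatives hSopen hSconn hSR hTconn
  have hsum : volume S + volume (openRectangle a b \ closure S) ≤ ENNReal.ofReal (a * b) := by
    rw [← hvol, ← measure_union (Set.disjoint_left.2 fun z hz hz' => hz'.2 (subset_closure hz))
      (isOpen_openRectangle.sdiff isClosed_closure).measurableSet]
    exact measure_mono (union_subset hSR sdiff_subset)
  rw [hvol]
  generalize μH[1] (openRectangle a b ∩ frontier S) = h at halt ⊢
  generalize volume S = s at halt hsum ⊢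
  generalize volume (openRectangle a b \ closure S) = t at halt hsum ⊢
  by_cases hh : h = ⊤
  · rw [hh, ENNReal.top_mul (ENNReal.ofReal_pos.2 hab).ne']
    exact le_top
  lift h to NNReal using hh
  lift s to NNReal using ne_top_of_le_ne_top ENNReal.ofReal_ne_top (le_self_add.trans hsum)
  lift t to NNReal using ne_top_of_le_ne_top ENNReal.ofReal_ne_top (le_add_self.trans hsum)
  have hs0 : (0 : ℝ) ≤ s := s.coe_nonneg
  have ht0 : (0 : ℝ) ≤ t := t.coe_nonneg
  have hh0 : (0 : ℝ) ≤ h := h.coe_nonneg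
  have hβ : 0 ≤ √2 - 1 := sub_nonneg.2 Real.one_lt_sqrt_two.le
  simp only [← ENNReal.ofReal_coe_nnreal] at halt hsum ⊢
  rw [← ENNReal.ofReal_add hs0 ht0, ENNReal.ofReal_le_ofReal_iff hab.le] at hsum
  rw [← ENNReal.ofReal_pow hh0, ← ENNReal.ofReal_mul hβ,
    ENNReal.ofReal_le_ofReal_iff hh0, ENNReal.ofReal_le_ofReal_iff hh0, ENNReal.ofReal_le_ofReal_iff (by positivity),
    ENNReal.ofReal_le_ofReal_iff (by positivity)] at halt
  rw [ge_iff_le, ← ENNReal.ofReal_mul hs0, ← ENNReal.ofReal_mul (by positivity),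
    ← ENNReal.ofReal_mul hh0]
  refine ENNReal.ofReal_le_ofReal ?_
  rw [div_mul_eq_mul_div, div_le_iff₀' ha]
  have hside (hbh : b ≤ h) : 4 * ((s : ℝ) * t) ≤ a * (h * (a * b)) :=
    calc 4 * ((s : ℝ) * t) ≤ (s + t) ^ 2 := by nlinarith [sq_nonneg ((s : ℝ) - t)]
      _ ≤ (a * b) ^ 2 := by gcongr
      _ = a * (b * (a * b)) := by ring
      _ ≤ _ := by gcongr
  rcases halt with hbh | hah | hs | ht
  · exact hside hbh
  · exact hside (hba.le.trans hah)
  · refine le_trans ?_ (four_mul_le_of_le_mul_sq hb hba hh0 hs0 (by linarith) hs)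
    gcongr
    linarith
  · refine le_trans ?_ (four_mul_le_of_le_mul_sq hb hba hh0 ht0 (by linarith) ht)
    rw [mul_comm (s : ℝ)]
    gcongr
    linarith
end

section
/- Let 0 < b < a and let R be the open rectangle {x | 0 < x 0 < a and 0 < x 1 < b} in EuclideanSpace ℝ (Fin 2). For S := {x ∈ R | x 0 < a/2} one has Γ := R ∩ frontier(S) = {x ∈ R | x 0 = a/2}, ℋ¹(Γ) = b, vol(S) = vol(R \ closure(S)) = a·b/2, and consequently ℋ¹(Γ) · vol(R) = (4/a) · vol(S) · vol(R \ closure(S)). (Lemma 1, achievement part: the straight cut across the middle of the long side attains the Ratio Cut value 4/a.) -/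
open MeasureTheory
open scoped ENNReal

open Filter Topology

/-- The volume of an open axis-parallel box in Euclidean space. -/
theorem EuclideanSpace.volume_box {ι : Type*} [Fintype ι] (l u : ι → ℝ) :
    volume {x : EuclideanSpace ℝ ι | ∀ i, x i ∈ Set.Ioo (l i) (u i)} =
      ∏ i, ENNReal.ofReal (u i - l i) := by
  rw [← Real.volume_pi_Ioo, ← (PiLp.volume_preserving_ofLp ι).measure_preimage
    (MeasurableSet.univ_pi fun i => measurableSet_Ioo).nullMeasurableSet]
  congr 1
  ext x
  simp

/-- The area of an open axis-parallel rectangle in the Euclidean plane. -/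
theorem EuclideanSpace.volume_rectangle {l r d u : ℝ} (hlr : l ≤ r) :
    volume {x : EuclideanSpace ℝ (Fin 2) | l < x 0 ∧ x 0 < r ∧ d < x 1 ∧ x 1 < u} =
      ENNReal.ofReal ((r - l) * (u - d)) := by
  have h := EuclideanSpace.volume_box ![l, d] ![r, u]
  simp only [Fin.forall_fin_two, Fin.prod_univ_two, Set.mem_Ioo, Matrix.cons_val_zero,
    Matrix.cons_val_one, and_assoc] at h
  rw [h, ENNReal.ofReal_mul (sub_nonneg.2 hlr)]

/-- A vertical line in the Euclidean plane is isometrically parametrized by its height. -/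
theorem EuclideanSpace.isometry_vertical_line (c : ℝ) :
    Isometry fun t : ℝ => (!₂[c, t] : EuclideanSpace ℝ (Fin 2)) := by
  refine Isometry.of_dist_eq fun s t => ?_
  simp [EuclideanSpace.dist_eq, Real.sqrt_sq_eq_abs, Real.dist_eq]

/-- The length of an open vertical segment in the Euclidean plane. -/
theorem EuclideanSpace.hausdorffMeasure_vertical_segment (c d u : ℝ) :
    μH[1] {x : EuclideanSpace ℝ (Fin 2) | x 0 = c ∧ d < x 1 ∧ x 1 < u} =
      ENNReal.ofReal (u - d) := by
  have himage : {x : EuclideanSpace ℝ (Fin 2) | x 0 = c ∧ d < x 1 ∧ x 1 < u} =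
      (fun t : ℝ => (!₂[c, t] : EuclideanSpace ℝ (Fin 2))) '' Set.Ioo d u := by
    ext x
    constructor
    · rintro ⟨hc, hd, hu⟩
      refine ⟨x 1, ⟨hd, hu⟩, ?_⟩
      ext i
      fin_cases i <;> simp [hc]
    · rintro ⟨t, ⟨hd, hu⟩, rfl⟩
      simp [hd, hu]
  rw [himage, (isometry_vertical_line c).hausdorffMeasure_image (Or.inl zero_le_one),
    hausdorffMeasure_real, Real.volume_Ioo]

/-- An open rectangle meets the closure of its part left of a vertical line `x 0 = c` in the
points on or left of that line. -/
theorem EuclideanSpace.rectangle_inter_closure {l r d u c : ℝ}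
    {R : Set (EuclideanSpace ℝ (Fin 2))}
    (hR : R = {x | l < x 0 ∧ x 0 < r ∧ d < x 1 ∧ x 1 < u}) :
    R ∩ closure {x ∈ R | x 0 < c} = {x ∈ R | x 0 ≤ c} := by
  ext x
  refine and_congr_right fun hxR => ⟨fun hx => ?_, fun hx => ?_⟩
  · have hclosed : IsClosed {y : EuclideanSpace ℝ (Fin 2) | y 0 ≤ c} :=
      isClosed_le (by fun_prop) continuous_const
    exact closure_minimal (fun y hy => hy.2.le) hclosed hx
  · subst hR
    obtain ⟨hl, hr, hd, hu⟩ := hxR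
    have hcont : Continuous fun t : ℝ => (!₂[t, x 1] : EuclideanSpace ℝ (Fin 2)) := by
      fun_prop
    have hlim : Tendsto (fun t : ℝ => (!₂[t, x 1] : EuclideanSpace ℝ (Fin 2)))
        (𝓝[<] (x 0)) (𝓝 x) := by
      have hx_eq : (!₂[x 0, x 1] : EuclideanSpace ℝ (Fin 2)) = x := by
        ext i
        fin_cases i <;> rfl
      simpa only [hx_eq] using (hcont.tendsto (x 0)).mono_left nhdsWithin_le_nhds
    refine mem_closure_of_tendsto hlim ?_
    filter_upwards [Ioo_mem_nhdsLT hl] with t ht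
    exact ⟨⟨ht.1, ht.2.trans hr, hd, hu⟩, ht.2.trans_le hx⟩

/-- Inside an open rectangle, the frontier of the part left of a vertical line is the part of
the rectangle on that line. -/
theorem EuclideanSpace.rectangle_inter_frontier {l r d u c : ℝ}
    {R : Set (EuclideanSpace ℝ (Fin 2))}
    (hR : R = {x | l < x 0 ∧ x 0 < r ∧ d < x 1 ∧ x 1 < u}) :
    R ∩ frontier {x ∈ R | x 0 < c} = {x ∈ R | x 0 = c} := by
  have hopen : IsOpen {x ∈ R | x 0 < c} := by
    subst hR
    have hcoord (i : Fin 2) : Continuous fun x : EuclideanSpace ℝ (Fin 2) => x i := by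
      fun_prop
    exact ((isOpen_lt continuous_const (hcoord 0)).inter <|
      (isOpen_lt (hcoord 0) continuous_const).inter <|
      (isOpen_lt continuous_const (hcoord 1)).inter <|
      isOpen_lt (hcoord 1) continuous_const).inter (isOpen_lt (hcoord 0) continuous_const)
  rw [hopen.frontier_eq, ← Set.inter_sdiff_assoc, rectangle_inter_closure hR]
  ext x
  simp only [Set.mem_sdiff, Set.mem_ofPred_eq, not_and, not_lt]
  exact ⟨fun h => ⟨h.1.1, h.1.2.antisymm (h.2 h.1.1)⟩,
    fun h => ⟨⟨h.1, h.2.le⟩, fun _ => h.2.ge⟩⟩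

/-- Lemma 1, achievement part: for the open rectangle `R = (0,a) × (0,b)` with
`0 < b < a`, the straight cut `S = {x ∈ R | x 0 < a/2}` across the middle of the
long side has `Γ := R ∩ frontier S = {x ∈ R | x 0 = a/2}`, `ℋ¹(Γ) = b`,
`vol(S) = vol(R \ closure S) = a·b/2`, and hence Ratio Cut value `4/a`:
`ℋ¹(Γ) · vol(R) = (4/a) · vol(S) · vol(R \ closure S)`. -/
theorem ratio_cut_rectangle_middle_cut
    (a b : ℝ) (hb : 0 < b) (hba : b < a)
    (R S : Set (EuclideanSpace ℝ (Fin 2)))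
    (hR : R = {x : EuclideanSpace ℝ (Fin 2) | 0 < x 0 ∧ x 0 < a ∧ 0 < x 1 ∧ x 1 < b})
    (hS : S = {x ∈ R | x 0 < a / 2}) :
    R ∩ frontier S = {x ∈ R | x 0 = a / 2} ∧
    μH[1] (R ∩ frontier S) = ENNReal.ofReal b ∧
    volume S = ENNReal.ofReal (a * b / 2) ∧
    volume (R \ closure S) = ENNReal.ofReal (a * b / 2) ∧
    μH[1] (R ∩ frontier S) * volume R =
      ENNReal.ofReal (4 / a) * (volume S * volume (R \ closure S)) := by
  have ha : 0 < a := hb.trans hba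
  have hfrontier : R ∩ frontier S = {x ∈ R | x 0 = a / 2} := by
    rw [hS, EuclideanSpace.rectangle_inter_frontier hR]
  have hlength : μH[1] (R ∩ frontier S) = ENNReal.ofReal b := by
    rw [hfrontier, ← sub_zero b, ← EuclideanSpace.hausdorffMeasure_vertical_segment (a / 2) 0 b]
    congr 1
    ext x
    simp only [hR, Set.mem_ofPred_eq]
    constructor
    · rintro ⟨⟨_, _, h⟩, hx⟩
      exact ⟨hx, h⟩
    · rintro ⟨hx, h⟩
      exact ⟨⟨by linarith, by linarith, h⟩, hx⟩
  have hvolR : volume R = ENNReal.ofReal (a * b) := by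
    rw [hR, EuclideanSpace.volume_rectangle ha.le, sub_zero, sub_zero]
  have hvolS : volume S = ENNReal.ofReal (a * b / 2) := by
    have hS_eq : S = {x | 0 < x 0 ∧ x 0 < a / 2 ∧ 0 < x 1 ∧ x 1 < b} := by
      ext x
      simp only [hS, hR, Set.mem_ofPred_eq]
      constructor
      · rintro ⟨⟨h0, _, h⟩, hx⟩
        exact ⟨h0, hx, h⟩
      · rintro ⟨h0, hx, h⟩
        exact ⟨⟨h0, by linarith, h⟩, hx⟩
    rw [hS_eq, EuclideanSpace.volume_rectangle (by linarith)]
    ring_nf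
  have hvolT : volume (R \ closure S) = ENNReal.ofReal (a * b / 2) := by
    have hT_eq : R \ closure S = {x | a / 2 < x 0 ∧ x 0 < a ∧ 0 < x 1 ∧ x 1 < b} := by
      rw [← Set.sdiff_self_inter, hS, EuclideanSpace.rectangle_inter_closure hR]
      ext x
      simp only [hR, Set.mem_sdiff, Set.mem_ofPred_eq, not_and, not_le]
      constructor
      · rintro ⟨hx, h⟩
        exact ⟨h hx, hx.2⟩
      · rintro ⟨hx, h⟩
        exact ⟨⟨by linarith, h⟩, fun _ => hx⟩
    rw [hT_eq, EuclideanSpace.volume_rectangle (by linarith)]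
    ring_nf
  refine ⟨hfrontier, hlength, hvolS, hvolT, ?_⟩
  rw [hlength, hvolR, hvolS, hvolT, ← ENNReal.ofReal_mul hb.le,
    ← ENNReal.ofReal_mul (by positivity), ← ENNReal.ofReal_mul (by positivity)]
  congr 1
  field_simp
  ring
end

section
/- Let a, b, x be real numbers with 0 < b ≤ a and 0 < x < 1. Then Real.sqrt (π·x·a·b) · (a·b) / ((x·a·b) · ((1 - x)·a·b)) ≥ 4.6/a. (Adjacent-sides case in the proof of Lemma 1: a cut touching two adjacent sides of an a×b rectangle, enclosing area x·a·b and of length at least √(π·x·a·b) by the isoperimetric inequality, yields Ratio Cut value at least (3/2)·√(3π)/a ≥ 4.6/a, strictly worse than the middle cut value 4/a.) -/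
open Real

/-- The maximum of `x * (1 - x) ^ 2` on `x ≤ 4 / 3`, attained at `x = 1 / 3`. -/
theorem mul_one_sub_sq_le {x : ℝ} (hx : x ≤ 4 / 3) : x * (1 - x) ^ 2 ≤ 4 / 27 := by
  have h := mul_nonneg (sq_nonneg (x - 1 / 3)) (sub_nonneg.2 hx)
  linarith

/-- Adjacent-sides case in the proof of Lemma 1: for `0 < b ≤ a` and `0 < x < 1`,
the Ratio Cut value of a cut of length `√(π·x·a·b)` enclosing area `x·a·b` in an
`a×b` rectangle is at least `4.6/a`. -/
theorem ratio_cut_adjacent_sides_bound (a b x : ℝ)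
    (hb : 0 < b) (hba : b ≤ a) (hx0 : 0 < x) (hx1 : x < 1) :
    Real.sqrt (π * x * a * b) * (a * b) / ((x * a * b) * ((1 - x) * a * b)) ≥ 4.6 / a := by
  have ha : 0 < a := hb.trans_le hba
  have hy : 0 < 1 - x := sub_pos.2 hx1
  have hcubic : x * (1 - x) ^ 2 ≤ 4 / 27 := mul_one_sub_sq_le (by linarith)
  have hcoef : 4.6 ^ 2 * (x * (1 - x) ^ 2) ≤ π := by
    have := pi_gt_d2
    norm_num at this ⊢
    linarith
  have hsqrt : 4.6 * (x * (1 - x) * b) ≤ Real.sqrt (π * x * a * b) := by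
    apply Real.le_sqrt_of_sq_le
    calc (4.6 * (x * (1 - x) * b)) ^ 2
        = 4.6 ^ 2 * (x * (1 - x) ^ 2) * b * (x * b) := by ring
      _ ≤ π * a * (x * b) := by gcongr
      _ = π * x * a * b := by ring
  rw [ge_iff_le, div_le_div_iff₀ ha (by positivity)]
  calc 4.6 * ((x * a * b) * ((1 - x) * a * b))
      = 4.6 * (x * (1 - x) * b) * (a * b * a) := by ring
    _ ≤ Real.sqrt (π * x * a * b) * (a * b * a) := by gcongr
    _ = Real.sqrt (π * x * a * b) * (a * b) * a := by ring
end

section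
/- Let d, r, ε₁ be real numbers with 0 < d ≤ 2·r and ε₁ > 0. If 2·r·Real.arcsin (d/(2·r)) ≤ (1 + 2·ε₁)·d, then d^2/r^2 ≤ 48·ε₁. (Step in the proof of Lemma 2: if the circular arc over the chord is only slightly longer than the chord, then the chord length is small compared to the radius.) -/
theorem monotone_sub_sin_sub_sin_cube :
    Monotone fun θ : ℝ => θ - Real.sin θ - Real.sin θ ^ 3 / 6 := by
  have hderiv (θ : ℝ) : HasDerivAt (fun θ : ℝ => θ - Real.sin θ - Real.sin θ ^ 3 / 6)
      (1 - Real.cos θ - 3 * Real.sin θ ^ 2 * Real.cos θ / 6) θ := by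
    simpa using ((hasDerivAt_id' θ).fun_sub (Real.hasDerivAt_sin θ)).fun_sub
      (((Real.hasDerivAt_sin θ).fun_pow 3).div_const 6)
  refine monotone_of_hasDerivAt_nonneg hderiv fun θ => ?_
  have hfactor : 1 - Real.cos θ - 3 * Real.sin θ ^ 2 * Real.cos θ / 6 =
      (Real.cos θ - 1) ^ 2 * (Real.cos θ + 2) / 2 := by
    rw [Real.sin_sq]
    ring
  have hcos : 0 ≤ Real.cos θ + 2 := by linarith [Real.neg_one_le_cos θ]
  simp only [Pi.zero_apply, hfactor]
  positivity

theorem add_cube_div_six_le_arcsin {x : ℝ} (hx₀ : 0 ≤ x) (hx₁ : x ≤ 1) :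
    x + x ^ 3 / 6 ≤ Real.arcsin x := by
  have h := monotone_sub_sin_sub_sin_cube (Real.arcsin_nonneg.2 hx₀)
  simp only [Real.sin_zero, Real.sin_arcsin (by linarith) hx₁] at h
  linarith

/-- Step in the proof of Lemma 2: if the circular arc of radius `r` over a chord
of length `d` (with `0 < d ≤ 2r`) is only slightly longer than the chord, namely
`2·r·arcsin(d/(2r)) ≤ (1 + 2ε₁)·d`, then `d²/r² ≤ 48·ε₁`. -/
theorem chord_small_of_arc_close (d r ε₁ : ℝ) (hd : 0 < d) (hdr : d ≤ 2 * r)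
    (hε : 0 < ε₁)
    (h : 2 * r * Real.arcsin (d / (2 * r)) ≤ (1 + 2 * ε₁) * d) :
    d ^ 2 / r ^ 2 ≤ 48 * ε₁ := by
  have hr : 0 < r := by linarith
  have harcsin := add_cube_div_six_le_arcsin (x := d / (2 * r)) (by positivity)
    ((div_le_one (by positivity)).2 hdr)
  have hle := (mul_le_mul_of_nonneg_left harcsin (by positivity : 0 ≤ 2 * r)).trans h
  have hexpand : 2 * r * (d / (2 * r) + (d / (2 * r)) ^ 3 / 6) =
      (1 + d ^ 2 / r ^ 2 / 24) * d := by
    field_simp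
    ring
  rw [hexpand] at hle
  linarith [le_of_mul_le_mul_right hle hd]
end

section
/- For every real ε₀ > 0 there exists δ > 0 such that for all real d, r with 0 < d ≤ δ·r, the area of the circular segment with chord length d and radius r satisfies r^2·Real.arcsin (d/(2·r)) - (d/2)·Real.sqrt (r^2 - d^2/4) ≤ (1 + ε₀)·d^3/(12·r). (Area bound for a shallow circular segment, proved inside Lemma 2 via Taylor expansion.) -/
theorem arcsin_sub_mul_sqrt_le {x : ℝ} (hx₀ : 0 < x) (hx₁ : x ≤ 1) :
    Real.arcsin x - x * Real.sqrt (1 - x ^ 2) ≤ 2 / 3 * Real.arcsin x ^ 3 := by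
  have hsin := Real.sin_gt_sub_cube (mul_pos two_pos (Real.arcsin_pos.2 hx₀))
  rw [Real.sin_two_mul, Real.sin_arcsin (by linarith) hx₁, Real.cos_arcsin] at hsin
  linarith

theorem exists_arcsin_le_mul {c : ℝ} (hc : 0 < c) :
    ∃ δ > 0, ∀ x : ℝ, 0 < x → x < δ → Real.arcsin x ≤ (1 + c) * x := by
  have hderiv : HasDerivAt Real.arcsin 1 0 := by
    simpa using Real.hasDerivAt_arcsin (x := 0) (by norm_num) (by norm_num)
  obtain ⟨δ, hδ, h⟩ := Metric.eventually_nhds_iff.1 (hderiv.isLittleO.def hc)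
  refine ⟨δ, hδ, fun x hx hxδ => ?_⟩
  have hle := h (y := x) (by simpa [abs_of_pos hx] using hxδ)
  simp only [Real.arcsin_zero, sub_zero, smul_eq_mul, mul_one, Real.norm_eq_abs,
    abs_of_pos hx] at hle
  linarith [le_abs_self (Real.arcsin x - x)]

/-- Area bound for a shallow circular segment, proved inside Lemma 2 via Taylor
expansion: for every `ε₀ > 0` there is a `δ > 0` such that whenever
`0 < d ≤ δ·r`, the area of the circular segment of chord `d` and radius `r`
satisfies `r²·arcsin(d/(2r)) − (d/2)·√(r² − d²/4) ≤ (1 + ε₀)·d³/(12r)`. -/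
theorem circular_segment_area_bound (ε₀ : ℝ) (hε₀ : 0 < ε₀) :
    ∃ δ > 0, ∀ d r : ℝ, 0 < d → d ≤ δ * r →
      r ^ 2 * Real.arcsin (d / (2 * r)) - (d / 2) * Real.sqrt (r ^ 2 - d ^ 2 / 4) ≤
        (1 + ε₀) * d ^ 3 / (12 * r) := by
  have hc : 0 < min 1 (ε₀ / 7) := lt_min one_pos (by positivity)
  obtain ⟨δ, hδ, harcsin⟩ := exists_arcsin_le_mul hc
  set c := min 1 (ε₀ / 7)
  have hcube : (1 + c) ^ 3 ≤ 1 + ε₀ := by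
    have h₁ : c ≤ 1 := min_le_left _ _
    have h₂ : c ≤ ε₀ / 7 := min_le_right _ _
    nlinarith [mul_nonneg hc.le (sub_nonneg.2 h₁),
      mul_nonneg (mul_nonneg hc.le hc.le) (sub_nonneg.2 h₁)]
  refine ⟨min 1 δ, lt_min one_pos hδ, fun d r hd hdr => ?_⟩
  have hr : 0 < r := pos_of_mul_pos_right (hd.trans_le hdr) (lt_min one_pos hδ).le
  obtain ⟨x, rfl⟩ : ∃ x, d = 2 * r * x := ⟨d / (2 * r), by field_simp⟩
  have hx : 0 < x := pos_of_mul_pos_right hd (by positivity)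
  have hxδ : 2 * x ≤ min 1 δ := le_of_mul_le_mul_right (by linarith) hr
  have hx₁ : 2 * x ≤ 1 := hxδ.trans (min_le_left _ _)
  have hx₂ : 2 * x ≤ δ := hxδ.trans (min_le_right _ _)
  have hsqrt : Real.sqrt (r ^ 2 - (2 * r * x) ^ 2 / 4) = r * Real.sqrt (1 - x ^ 2) := by
    rw [show r ^ 2 - (2 * r * x) ^ 2 / 4 = r ^ 2 * (1 - x ^ 2) by ring,
      Real.sqrt_mul (sq_nonneg r), Real.sqrt_sq hr.le]
  rw [hsqrt, mul_div_cancel_left₀ x (by positivity)]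
  have hpow : Real.arcsin x ^ 3 ≤ (1 + ε₀) * x ^ 3 :=
    calc Real.arcsin x ^ 3 ≤ ((1 + c) * x) ^ 3 :=
          pow_le_pow_left₀ (Real.arcsin_nonneg.2 hx.le) (harcsin x hx (by linarith)) 3
      _ = (1 + c) ^ 3 * x ^ 3 := mul_pow _ _ _
      _ ≤ (1 + ε₀) * x ^ 3 := by gcongr
  calc r ^ 2 * Real.arcsin x - 2 * r * x / 2 * (r * Real.sqrt (1 - x ^ 2))
      = r ^ 2 * (Real.arcsin x - x * Real.sqrt (1 - x ^ 2)) := by ring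
    _ ≤ r ^ 2 * (2 / 3 * ((1 + ε₀) * x ^ 3)) := by
        gcongr
        linarith [arcsin_sub_mul_sqrt_le hx (by linarith)]
    _ = (1 + ε₀) * (2 * r * x) ^ 3 / (12 * r) := by
        field_simp
        ring
end

section
/- For every real ε₀ > 0 there exists ε₁ > 0 such that the following holds: for all real d, r with 0 < d ≤ 2·r, if the arc length L := 2·r·Real.arcsin (d/(2·r)) satisfies L + d ≤ (1 + ε₁)·2·d, then the circular segment area satisfies r^2·Real.arcsin (d/(2·r)) - (d/2)·Real.sqrt (r^2 - d^2/4) ≤ ((1 + ε₀)/Real.sqrt 6) · d^(3/2) · Real.sqrt (L - d). (Lemma 2 in the case of a circular arc: if the total boundary length L + d of the segment is at most (1+ε₁) times twice the chord length, then the enclosed area is at most ((1+ε₀)/√6)·d^{3/2}·√(perimeter − 2d).) -/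
open Real in
theorem cos_le_one_sub_sq_add_quartic {x : ℝ} (hx : 0 ≤ x) (hx' : x ≤ 2) :
    cos x ≤ 1 - x ^ 2 / 2 + x ^ 4 / 24 := by
  have hsin : x / 2 - (x / 2) ^ 3 / 6 ≤ sin (x / 2) := sin_ge_sub_cube (by linarith)
  have hnonneg : 0 ≤ x / 2 - (x / 2) ^ 3 / 6 := by
    have hsq : x ^ 2 ≤ 4 := by nlinarith
    nlinarith [mul_nonneg hx (sub_nonneg.2 hsq)]
  have hsq := pow_le_pow_left₀ hnonneg hsin 2
  have hcos : cos x = 1 - 2 * sin (x / 2) ^ 2 := by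
    have h := cos_two_mul (x / 2)
    rw [show 2 * (x / 2) = x by ring, cos_sq'] at h
    linarith
  nlinarith [pow_nonneg hx 6]

open Real in
theorem sin_le_sub_cube_add_quintic {x : ℝ} (hx : 0 ≤ x) (hx' : x ≤ 2) :
    sin x ≤ x - x ^ 3 / 6 + x ^ 5 / 120 := by
  let f (t : ℝ) : ℝ := t - t ^ 3 / 6 + t ^ 5 / 120 - sin t
  have hderiv (t : ℝ) : HasDerivAt f (1 - t ^ 2 / 2 + t ^ 4 / 24 - cos t) t := by
    have h := ((((hasDerivAt_id t).sub ((hasDerivAt_pow 3 t).div_const 6)).add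
      ((hasDerivAt_pow 5 t).div_const 120)).sub (hasDerivAt_sin t))
    refine h.congr_deriv ?_
    norm_num
    ring
  have hmono : MonotoneOn f (Set.Icc 0 2) := by
    refine monotoneOn_of_deriv_nonneg (convex_Icc 0 2)
      (fun t _ => (hderiv t).continuousAt.continuousWithinAt)
      (fun t _ => (hderiv t).differentiableAt.differentiableWithinAt) fun t ht => ?_
    have ht' := interior_subset ht
    rw [(hderiv t).deriv]
    linarith [cos_le_one_sub_sq_add_quartic ht'.1 ht'.2]
  have h := hmono ⟨le_rfl, by norm_num⟩ ⟨hx, hx'⟩ hx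
  simp only [f, sin_zero] at h
  linarith

open Real in
theorem sub_sin_mul_cos_le {x : ℝ} (hx : 0 ≤ x) : x - sin x * cos x ≤ 2 * x ^ 3 / 3 := by
  have h := sin_ge_sub_cube (x := 2 * x) (by linarith)
  rw [sin_two_mul] at h
  linarith

open Real in
/-- The area bound for the segment of half-angle `x` of the unit circle, squared. -/
theorem sq_sub_sin_mul_cos_le {x e : ℝ} (hx : 0 < x) (hx' : x ≤ 2) (he : 0 ≤ e) (he' : e ≤ 1)
    (h : x ≤ (1 + e / 50) * sin x) :
    (x - sin x * cos x) ^ 2 ≤ (1 + e) ^ 2 / 6 * (2 * sin x) ^ 3 * (2 * x - 2 * sin x) := by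
  have hle : sin x ≤ x := sin_le hx.le
  have hquintic := sin_le_sub_cube_add_quintic hx.le hx'
  have hsin_lower : (1 - e / 50) * x ≤ sin x := by
    nlinarith [mul_nonneg he (sub_nonneg.2 hle)]
  have hsub : x ^ 3 / 6 * (1 - x ^ 2 / 20) ≤ x - sin x := by linarith
  have hsq_le : x ^ 2 ≤ 4 := by nlinarith
  have hsmall : x ^ 2 / 20 ≤ e / 125 := by
    have hmul : x * (x ^ 2) ≤ x * (4 / 25 * e) := by
      nlinarith [mul_nonneg (pow_nonneg hx.le 3) (sub_nonneg.2 hsq_le),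
        mul_nonneg he (sub_nonneg.2 hle)]
    linarith [le_of_mul_le_mul_left hmul hx]
  have hsub' : x ^ 3 / 6 * (1 - e / 125) ≤ x - sin x := by
    refine le_trans ?_ hsub
    gcongr
  have hcube : ((1 - e / 50) * x) ^ 3 ≤ sin x ^ 3 :=
    pow_le_pow_left₀ (mul_nonneg (by linarith) hx.le) hsin_lower 3
  have harea_nonneg : 0 ≤ x - sin x * cos x := by
    have hs : 0 ≤ sin x := le_trans (mul_nonneg (by linarith) hx.le) hsin_lower
    nlinarith [mul_nonneg hs (sub_nonneg.2 (cos_le_one x))]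
  have harea := pow_le_pow_left₀ harea_nonneg (sub_sin_mul_cos_le hx.le) 2
  have hprod : ((1 - e / 50) * x) ^ 3 * (x ^ 3 / 6 * (1 - e / 125)) ≤
      sin x ^ 3 * (x - sin x) :=
    mul_le_mul hcube hsub' (mul_nonneg (by positivity) (by linarith))
      (le_trans (pow_nonneg (mul_nonneg (by linarith) hx.le) 3) hcube)
  have hconst : 1 ≤ (1 + e) ^ 2 * ((1 - e / 50) ^ 3 * (1 - e / 125)) := by
    have h₁ : 1 - 3 * e / 50 ≤ (1 - e / 50) ^ 3 := by
      nlinarith [mul_nonneg (sq_nonneg e) (show 0 ≤ 3 - e / 50 by linarith)]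
    have h₂ : 1 - e / 10 ≤ (1 - e / 50) ^ 3 * (1 - e / 125) := by
      nlinarith [mul_le_mul_of_nonneg_right h₁ (show 0 ≤ 1 - e / 125 by linarith)]
    have h₃ : 1 + 2 * e ≤ (1 + e) ^ 2 := by nlinarith
    have h₄ := mul_le_mul h₃ h₂ (by linarith) (sq_nonneg _)
    nlinarith
  calc (x - sin x * cos x) ^ 2 ≤ (2 * x ^ 3 / 3) ^ 2 := harea
    _ = 4 / 9 * x ^ 6 * 1 := by ring
    _ ≤ 4 / 9 * x ^ 6 * ((1 + e) ^ 2 * ((1 - e / 50) ^ 3 * (1 - e / 125))) := by gcongr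
    _ = 8 / 3 * (1 + e) ^ 2 * (((1 - e / 50) * x) ^ 3 * (x ^ 3 / 6 * (1 - e / 125))) := by ring
    _ ≤ 8 / 3 * (1 + e) ^ 2 * (sin x ^ 3 * (x - sin x)) := by gcongr
    _ = _ := by ring


/-- Lemma 2 in the case of a circular arc: for every `ε₀ > 0` there is an
`ε₁ > 0` such that, for `0 < d ≤ 2r`, if the boundary length `L + d` of the
circular segment (where `L = 2·r·arcsin(d/(2r))` is the arc length) is at most
`(1 + ε₁)` times twice the chord length `d`, then the segment area is at most
`((1 + ε₀)/√6)·d^{3/2}·√(L − d)`. -/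
theorem circular_segment_area_bound_of_perimeter (ε₀ : ℝ) (hε₀ : 0 < ε₀) :
    ∃ ε₁ > 0, ∀ d r : ℝ, 0 < d → d ≤ 2 * r →
      2 * r * Real.arcsin (d / (2 * r)) + d ≤ (1 + ε₁) * 2 * d →
      r ^ 2 * Real.arcsin (d / (2 * r)) - (d / 2) * Real.sqrt (r ^ 2 - d ^ 2 / 4) ≤
        ((1 + ε₀) / Real.sqrt 6) * d ^ ((3 : ℝ) / 2) *
          Real.sqrt (2 * r * Real.arcsin (d / (2 * r)) - d) := by
  have he : 0 < min ε₀ 1 := lt_min hε₀ one_pos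
  refine ⟨min ε₀ 1 / 100, by positivity, fun d r hd hdr hL => ?_⟩
  have hr : 0 < r := by linarith
  have hratio : d / (2 * r) ≤ 1 := (div_le_one (by linarith)).2 hdr
  have hratio_pos : 0 < d / (2 * r) := by positivity
  have hsin : Real.sin (Real.arcsin (d / (2 * r))) = d / (2 * r) :=
    Real.sin_arcsin (by linarith) hratio
  have hpos : 0 < Real.arcsin (d / (2 * r)) := Real.arcsin_pos.2 hratio_pos
  have hle : Real.arcsin (d / (2 * r)) ≤ 2 := by
    linarith [Real.arcsin_le_pi_div_two (d / (2 * r)), Real.pi_le_four]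
  have hcos := Real.cos_arcsin_nonneg (d / (2 * r))
  set x := Real.arcsin (d / (2 * r))
  have hd_eq : d = 2 * r * Real.sin x := by
    rw [hsin]
    field_simp
  have hsqrt : Real.sqrt (r ^ 2 - d ^ 2 / 4) = r * Real.cos x := by
    rw [← Real.sqrt_sq (mul_nonneg hr.le hcos)]
    congr 1
    rw [hd_eq, mul_pow r, Real.cos_sq']
    ring
  have hx : x ≤ (1 + min ε₀ 1 / 50) * Real.sin x := by
    refine le_of_mul_le_mul_left ?_ (show 0 < 2 * r by linarith)
    linear_combination hL + (1 + min ε₀ 1 / 50) * hd_eq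
  have hlength : 0 ≤ 2 * r * x - d := by
    rw [hd_eq, ← mul_sub]
    exact mul_nonneg (by linarith) (sub_nonneg.2 (Real.sin_le hpos.le))
  have hrpow : (d ^ ((3 : ℝ) / 2)) ^ 2 = d ^ 3 := by
    rw [← Real.rpow_natCast, ← Real.rpow_mul hd.le, ← Real.rpow_natCast]
    norm_num
  refine le_trans (le_abs_self _) (abs_le_of_sq_le_sq ?_ (by positivity))
  rw [mul_pow, mul_pow, div_pow, Real.sq_sqrt (by norm_num), Real.sq_sqrt hlength, hrpow, hsqrt]
  calc (r ^ 2 * x - d / 2 * (r * Real.cos x)) ^ 2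
      = r ^ 4 * (x - Real.sin x * Real.cos x) ^ 2 := by
        rw [hd_eq]
        ring
    _ ≤ r ^ 4 * ((1 + min ε₀ 1) ^ 2 / 6 * (2 * Real.sin x) ^ 3 * (2 * x - 2 * Real.sin x)) := by
        gcongr
        exact sq_sub_sin_mul_cos_le hpos hle he.le (min_le_right _ _) hx
    _ = (1 + min ε₀ 1) ^ 2 / 6 * d ^ 3 * (2 * r * x - d) := by
        rw [hd_eq]
        ring
    _ ≤ (1 + ε₀) ^ 2 / 6 * d ^ 3 * (2 * r * x - d) := by
        gcongr
        exact min_le_left _ _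
end

section
/- The function θ ↦ (θ - Real.sin θ)/(8·(Real.sin (θ/2))^2) - θ/12 - θ^3/360 is O(θ^4) as θ → 0; that is, Asymptotics.IsBigO (nhds 0) (fun θ => (θ - Real.sin θ)/(8·(Real.sin (θ/2))^2) - θ/12 - θ^3/360) (fun θ => θ^4). (Taylor expansion of the normalized circular-segment area used in Section 5: the circular segment over a chord of length c with opening angle θ has area c²·(θ/12 + θ³/360 + O(θ⁴)).) -/
open Asymptotics

lemma norm_exp_mul_I_sub_taylor_le {x : ℝ} (hx : |x| ≤ 1) :
    ‖Complex.exp (x * Complex.I) - (((1 - x ^ 2 / 2 + x ^ 4 / 24 : ℝ) : ℂ)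
      + ((x - x ^ 3 / 6 + x ^ 5 / 120 : ℝ) : ℂ) * Complex.I)‖ ≤ |x| ^ 6 * (7 / 4320) := by
  have hn : ‖(x * Complex.I : ℂ)‖ = |x| := by simp
  have h := Complex.exp_bound (x := x * Complex.I) (hn.trans_le hx) (n := 6) (by norm_num)
  rw [hn] at h
  convert h using 2
  · congr 1
    have h4 : Complex.I ^ 4 = 1 := Complex.I_pow_four
    have h3 : Complex.I ^ 3 = -Complex.I := Complex.I_pow_three
    have h5 : Complex.I ^ 5 = Complex.I := by rw [pow_succ, h4, one_mul]
    simp [Finset.sum_range_succ, Nat.factorial, mul_pow, h3, h4, h5]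
    ring
  · norm_num [Nat.factorial]

lemma abs_cos_sub_taylor_le {x : ℝ} (hx : |x| ≤ 1) :
    |Real.cos x - (1 - x ^ 2 / 2 + x ^ 4 / 24)| ≤ |x| ^ 6 * (7 / 4320) := by
  refine le_trans ?_ ((Complex.abs_re_le_norm _).trans (norm_exp_mul_I_sub_taylor_le hx))
  rw [Complex.sub_re, Complex.exp_ofReal_mul_I_re, Complex.add_re, Complex.re_ofReal_mul,
    Complex.ofReal_re, Complex.I_re, mul_zero, add_zero]

lemma abs_sin_sub_taylor_le {x : ℝ} (hx : |x| ≤ 1) :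
    |Real.sin x - (x - x ^ 3 / 6 + x ^ 5 / 120)| ≤ |x| ^ 6 * (7 / 4320) := by
  refine le_trans ?_ ((Complex.abs_im_le_norm _).trans (norm_exp_mul_I_sub_taylor_le hx))
  rw [Complex.sub_im, Complex.exp_ofReal_mul_I_im, Complex.add_im, Complex.im_ofReal_mul,
    Complex.ofReal_im, Complex.I_im, mul_one, zero_add]

/-- Taylor expansion of the normalized circular-segment area used in Section 5:
the circular segment over a chord of length `c` with opening angle `θ` has area
`c²·(θ − sin θ)/(8·sin²(θ/2)) = c²·(θ/12 + θ³/360 + O(θ⁴))`; i.e.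
`(θ − sin θ)/(8·sin²(θ/2)) − θ/12 − θ³/360 = O(θ⁴)` as `θ → 0`. -/
theorem segment_area_taylor :
    Asymptotics.IsBigO (nhds (0 : ℝ))
      (fun θ : ℝ => (θ - Real.sin θ) / (8 * (Real.sin (θ / 2)) ^ 2) - θ / 12 - θ ^ 3 / 360)
      (fun θ : ℝ => θ ^ 4) := by
  refine IsBigO.of_bound 1 ?_
  filter_upwards [Metric.closedBall_mem_nhds (0 : ℝ) one_pos] with x hx
  replace hx : |x| ≤ 1 := by simpa using hx
  rw [one_mul, Real.norm_eq_abs, Real.norm_eq_abs, abs_pow]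
  rcases eq_or_ne x 0 with rfl | hx0
  · simp
  have hpos : 0 < |x| := abs_pos.mpr hx0
  have hc := abs_cos_sub_taylor_le hx
  have hs := abs_sin_sub_taylor_le hx
  have hden : 8 * Real.sin (x / 2) ^ 2 = 4 * (1 - Real.cos x) := by
    rw [Real.sin_sq_eq_half_sub, mul_div_cancel₀ x two_ne_zero]
    ring
  set K := Real.cos x - (1 - x ^ 2 / 2 + x ^ 4 / 24) with hK
  set S := Real.sin x - (x - x ^ 3 / 6 + x ^ 5 / 120) with hS
  have hle : |x| ^ 2 ≤ 4 * (1 - Real.cos x) := by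
    have h4 : |x| ^ 4 ≤ |x| ^ 2 := pow_le_pow_of_le_one hpos.le hx (by norm_num)
    have h6 : |x| ^ 6 ≤ |x| ^ 2 := pow_le_pow_of_le_one hpos.le hx (by norm_num)
    have e2 : |x| ^ 2 = x ^ 2 := sq_abs x
    have e4 : |x| ^ 4 = x ^ 4 := Even.pow_abs (by decide) x
    nlinarith [(abs_le.mp hc).2, sq_nonneg x]
  have hdpos : 0 < 4 * (1 - Real.cos x) := (pow_pos hpos 2).trans_le hle
  have hnum : |(x - Real.sin x) - 4 * (1 - Real.cos x) * (x / 12 + x ^ 3 / 360)| ≤ |x| ^ 6 := by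
    have heq : (x - Real.sin x) - 4 * (1 - Real.cos x) * (x / 12 + x ^ 3 / 360)
        = -S + 4 * K * (x / 12 + x ^ 3 / 360) + x ^ 7 / 2160 := by
      rw [hK, hS]
      ring
    have h3 : |x| ^ 3 ≤ 1 := pow_le_one₀ hpos.le hx
    have h7 : |x| ^ 7 ≤ |x| ^ 6 := pow_le_pow_of_le_one hpos.le hx (by norm_num)
    have hq : |x / 12 + x ^ 3 / 360| ≤ 1 := by
      refine (abs_add_le _ _).trans ?_
      rw [abs_div, abs_div, abs_pow]
      norm_num
      linarith
    have hKq : |K| * |x / 12 + x ^ 3 / 360| ≤ |K| := mul_le_of_le_one_right (abs_nonneg _) hq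
    calc _ = |-S + 4 * K * (x / 12 + x ^ 3 / 360) + x ^ 7 / 2160| := by rw [heq]
      _ ≤ |S| + 4 * (|K| * |x / 12 + x ^ 3 / 360|) + |x| ^ 7 / 2160 := by
        refine (abs_add_three _ _ _).trans_eq ?_
        rw [abs_neg, abs_mul, abs_mul, abs_div, abs_pow]
        norm_num
        ring
      _ ≤ |x| ^ 6 := by linarith [pow_pos hpos 6]
  have hquot : (x - Real.sin x) / (4 * (1 - Real.cos x)) - x / 12 - x ^ 3 / 360
      = ((x - Real.sin x) - 4 * (1 - Real.cos x) * (x / 12 + x ^ 3 / 360))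
        / (4 * (1 - Real.cos x)) := by
    rw [sub_div (x - Real.sin x), mul_div_cancel_left₀ _ hdpos.ne']
    ring
  rw [hden, hquot, abs_div, abs_of_pos hdpos, div_le_iff₀ hdpos]
  calc _ ≤ |x| ^ 6 := hnum
    _ = |x| ^ 4 * |x| ^ 2 := by ring
    _ ≤ _ := by gcongr
end

section
/- There exists a function f : ℝ → ℝ which is C^∞ on the open interval (-π, π) (ContDiffOn ℝ ⊤ f (Set.Ioo (-π) π)), such that f 0 = 0 and f θ = (θ - Real.sin θ)/(8·(Real.sin (θ/2))^2) for every θ ∈ (-π, π) with θ ≠ 0. (Smooth removable singularity of the normalized circular-cap area at opening angle θ = 0; this is the analytic core of the claim in Section 4 that the Ratio Cut function RC(p,q,θ) is a smooth function of (p,q,θ) in a neighborhood of (1/2, 1/2, 0).) -/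
open Real

/-- The divided difference of an everywhere analytic function is everywhere analytic. -/
theorem AnalyticOnNhd.dslope_univ {f : ℝ → ℝ} (hf : AnalyticOnNhd ℝ f Set.univ) (a : ℝ) :
    AnalyticOnNhd ℝ (dslope f a) Set.univ := by
  intro x _
  by_cases hx : x = a
  · subst hx
    obtain ⟨p, hp⟩ := hf x (Set.mem_univ x)
    exact ⟨_, hp.has_fpower_series_dslope_fslope⟩
  · have h : AnalyticAt ℝ (fun y => (f y - f a) / (y - a)) x :=
      ((hf x (Set.mem_univ x)).sub analyticAt_const).div
        (analyticAt_id.sub analyticAt_const) (sub_ne_zero.2 hx)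
    refine h.congr ?_
    filter_upwards [isOpen_ne.mem_nhds hx] with y hy
    rw [dslope_of_ne _ hy, slope_def_field]

/-- The derivative of an even function vanishes at the origin. -/
theorem Function.Even.deriv_zero {f : ℝ → ℝ} (hf : Function.Even f) : deriv f 0 = 0 := by
  have h := deriv_comp_neg f 0
  simp only [hf _, neg_zero] at h
  linarith

/-- Smooth removable singularity of the normalized circular-cap area at opening
angle `θ = 0`: there is a function `f : ℝ → ℝ`, infinitely differentiable on
`(−π, π)`, with `f 0 = 0` and `f θ = (θ − sin θ)/(8·sin²(θ/2))` for all nonzero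
`θ ∈ (−π, π)`. This is the analytic core of the Section 4 claim that the Ratio
Cut function `RC(p,q,θ)` is smooth near `(1/2, 1/2, 0)`. -/
theorem cap_area_smooth_extension :
    ∃ f : ℝ → ℝ, ContDiffOn ℝ (⊤ : ℕ∞) f (Set.Ioo (-π) π) ∧ f 0 = 0 ∧
      ∀ θ ∈ Set.Ioo (-π) π, θ ≠ 0 →
        f θ = (θ - Real.sin θ) / (8 * (Real.sin (θ / 2)) ^ 2) := by
  let A : ℝ → ℝ := fun θ => θ - sin θ
  let S : ℝ → ℝ := fun θ => sin (θ / 2)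
  have hA : AnalyticOnNhd ℝ A Set.univ := fun x _ => analyticAt_id.sub analyticAt_sin
  have hS : AnalyticOnNhd ℝ S Set.univ := fun x _ =>
    analyticAt_sin.comp (analyticAt_id.div analyticAt_const two_ne_zero)
  have hA' : deriv A 0 = 0 := by
    have h : HasDerivAt A (1 - cos 0) 0 := (hasDerivAt_id 0).sub (hasDerivAt_sin 0)
    rw [h.deriv, cos_zero, sub_self]
  have hS' : deriv S 0 = 1 / 2 := by
    have h : HasDerivAt S (cos (0 / 2) * (1 / 2)) 0 := ((hasDerivAt_id 0).div_const 2).sin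
    rw [h.deriv, zero_div, cos_zero, one_mul]
  have hg (x : ℝ) (hx : x ≠ 0) : dslope A 0 x = A x / x := by
    simp [dslope_of_ne _ hx, slope_def_field, A]
  have hg0 : dslope A 0 0 = 0 := by rw [dslope_same, hA']
  have hk (x : ℝ) (hx : x ≠ 0) : dslope (dslope A 0) 0 x = A x / x / x := by
    rw [dslope_of_ne _ hx, slope_def_field, hg0, hg x hx, sub_zero, sub_zero]
  have hs (x : ℝ) (hx : x ≠ 0) : dslope S 0 x = S x / x := by
    simp [dslope_of_ne _ hx, slope_def_field, S]
  have hEven : Function.Even (dslope A 0) := by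
    intro x
    by_cases hx : x = 0
    · simp [hx]
    · rw [hg x hx, hg (-x) (neg_ne_zero.2 hx)]
      simp only [A, sin_neg]
      field_simp
      ring
  have hS_ne (x : ℝ) (hx : x ∈ Set.Ioo (-π) π) (hx0 : x ≠ 0) : S x ≠ 0 := by
    have h := hx.1
    have h' := hx.2
    intro h0
    have := (sin_eq_zero_iff_of_lt_of_lt (by linarith [pi_pos]) (by linarith [pi_pos])).1 h0
    exact hx0 (by linarith)
  have hs_ne (x : ℝ) (hx : x ∈ Set.Ioo (-π) π) : dslope S 0 x ≠ 0 := by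
    by_cases hx0 : x = 0
    · rw [hx0, dslope_same, hS']
      norm_num
    · rw [hs x hx0]
      exact div_ne_zero (hS_ne x hx hx0) hx0
  refine ⟨fun θ => dslope (dslope A 0) 0 θ / (8 * dslope S 0 θ ^ 2), ?_, ?_, ?_⟩
  · intro x hx
    exact ((((hA.dslope_univ 0).dslope_univ 0) x (Set.mem_univ x)).div
      (analyticAt_const.mul ((hS.dslope_univ 0 x (Set.mem_univ x)).pow 2))
      (mul_ne_zero (by norm_num) (pow_ne_zero 2 (hs_ne x hx)))).contDiffAt.contDiffWithinAt
  · simp [dslope_same, hEven.deriv_zero]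
  · intro θ hθ h0
    have h := hS_ne θ hθ h0
    change _ = A θ / (8 * S θ ^ 2)
    simp only [hk θ h0, hs θ h0]
    field_simp
end
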